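/- Let g and h be multiplicative arithmetic functions with 0 ≤ g(p) < 1 and h(p) = g(p)/(1 − g(p)) for every prime p, and let A_1 ≥ 1, A_2 > 0, L > 0, κ > 0 be constants such that: (i) 0 ≤ g(p) ≤ 1 − 1/A_1 for every prime p; and (ii) −L ≤ ∑_{u ≤ p < v, p prime} g(p)·ln p − κ·ln(v/u) ≤ A_2 for all reals 2 ≤ u ≤ v. Set H(z) = ∑_{k ≤ z} μ(k)²h(k) and W(z) = ∏_{p < z} (1 − g(p)). Then there is a constant C depending only on A_1, A_2, κ such that for all z ≥ 2: 1/H(z) = W(z)·e^{γκ}·Γ(κ+1)·(1 + θ·C·L/ln z) for some real θ with |θ| ≤ 1. -/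

import Mathlib

open Finset

/-- The summatory function `x ↦ ∑_{n ≤ x} w n`. -/
noncomputable def summatory (w : ℕ → ℝ) (x : ℝ) : ℝ := ∑ n ∈ Finset.Icc 0 ⌊x⌋₊, w n

theorem measurable_summatory (w : ℕ → ℝ) : Measurable (summatory w) := by
  have h : Measurable (fun N : ℕ => ∑ n ∈ Finset.Icc 0 N, w n) := measurable_from_top
  exact h.comp Nat.measurable_floor

section Laplace
open MeasureTheory Filter Topology

theorem lintegral_Ici_indicator_exp_neg {c : ℝ} (hc : 0 ≤ c) :
    ∫⁻ x in Set.Ioi (0 : ℝ), (Set.Ici c).indicator (fun x => ENNReal.ofReal (Real.exp (-x))) x =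
      ENNReal.ofReal (Real.exp (-c)) := by
  have h1 : (fun x => (Set.Ici c).indicator (fun x => ENNReal.ofReal (Real.exp (-x))) x) =ᵐ[volume]
      (Set.Ioi c).indicator (fun x => ENNReal.ofReal (Real.exp (-x))) :=
    indicator_ae_eq_of_ae_eq_set Ioi_ae_eq_Ici.symm
  rw [lintegral_congr_ae (ae_restrict_of_ae h1), lintegral_indicator measurableSet_Ioi,
    Measure.restrict_restrict measurableSet_Ioi,
    Set.inter_eq_left.mpr (Set.Ioi_subset_Ioi hc),
    ← ofReal_integral_eq_lintegral_ofReal (integrableOn_exp_neg_Ioi c)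
      (ae_of_all _ fun x => (Real.exp_pos _).le), integral_exp_neg_Ioi]

theorem tsum_ofReal_mul_rpow_neg (w : ℕ → ℝ) (hw : ∀ n, 0 ≤ w n) (h0 : w 0 = 0) {s : ℝ}
    (hs : 0 < s) :
    ∑' n : ℕ, ENNReal.ofReal (w n * (n : ℝ) ^ (-s)) =
      ∫⁻ x in Set.Ioi (0 : ℝ), ENNReal.ofReal (summatory w (Real.exp (x / s)) * Real.exp (-x)) := by
  have key : ∀ x : ℝ, ENNReal.ofReal (summatory w (Real.exp (x / s)) * Real.exp (-x)) =
      ∑' n : ℕ, ENNReal.ofReal (w n) *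
        (Set.Ici (s * Real.log n)).indicator (fun x => ENNReal.ofReal (Real.exp (-x))) x := by
    intro x
    rw [tsum_eq_sum (s := Finset.Icc 0 ⌊Real.exp (x / s)⌋₊)]
    · rw [summatory, Finset.sum_mul, ENNReal.ofReal_sum_of_nonneg
        (fun n _ => mul_nonneg (hw n) (Real.exp_pos _).le)]
      refine Finset.sum_congr rfl fun n hn => ?_
      rcases Nat.eq_zero_or_pos n with rfl | hn0
      · simp [h0]
      have hn0' : (0 : ℝ) < n := by exact_mod_cast hn0
      rw [Finset.mem_Icc, Nat.le_floor_iff (Real.exp_pos _).le] at hn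
      have : s * Real.log n ≤ x := by
        have := (Real.log_le_iff_le_exp hn0').mpr hn.2
        rwa [le_div_iff₀ hs, mul_comm] at this
      rw [Set.indicator_of_mem (Set.mem_Ici.mpr this), ENNReal.ofReal_mul (hw n)]
    · intro n hn
      rcases Nat.eq_zero_or_pos n with rfl | hn0
      · simp [h0]
      have hn0' : (0 : ℝ) < n := by exact_mod_cast hn0
      rw [Finset.mem_Icc, Nat.le_floor_iff (Real.exp_pos _).le] at hn
      have : ¬ s * Real.log n ≤ x := by
        intro h
        apply hn
        refine ⟨Nat.zero_le _, (Real.log_le_iff_le_exp hn0').mp ?_⟩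
        rwa [le_div_iff₀ hs, mul_comm]
      rw [Set.indicator_of_notMem (by simpa using this), mul_zero]
  simp_rw [key]
  have hmeas : ∀ n : ℕ, Measurable ((Set.Ici (s * Real.log n)).indicator
      (fun x => ENNReal.ofReal (Real.exp (-x)))) := fun n =>
    Measurable.indicator (by fun_prop) measurableSet_Ici
  rw [lintegral_tsum fun n => ((hmeas n).const_mul _).aemeasurable]
  refine tsum_congr fun n => ?_
  rw [lintegral_const_mul _ (hmeas n)]
  rcases Nat.eq_zero_or_pos n with rfl | hn0
  · simp [h0]
  have hn0' : (0 : ℝ) < n := by exact_mod_cast hn0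
  rw [lintegral_Ici_indicator_exp_neg
    (mul_nonneg hs.le (Real.log_nonneg (by exact_mod_cast hn0))), ENNReal.ofReal_mul (hw n),
    Real.rpow_def_of_pos hn0']
  congr 3; ring

/-- A Dirichlet series with nonnegative coefficients as a Laplace transform. -/
theorem hasSum_mul_rpow_neg (w : ℕ → ℝ) (hw : ∀ n, 0 ≤ w n) (h0 : w 0 = 0) {s : ℝ} (hs : 0 < s)
    (hInt : IntegrableOn (fun x => summatory w (Real.exp (x / s)) * Real.exp (-x)) (Set.Ioi 0)) :
    HasSum (fun n : ℕ => w n * (n : ℝ) ^ (-s))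
      (∫ x in Set.Ioi (0 : ℝ), summatory w (Real.exp (x / s)) * Real.exp (-x)) := by
  have hnn : ∀ x : ℝ, 0 ≤ summatory w (Real.exp (x / s)) * Real.exp (-x) := fun x =>
    mul_nonneg (Finset.sum_nonneg fun n _ => hw n) (Real.exp_pos _).le
  have h1 := tsum_ofReal_mul_rpow_neg w hw h0 hs
  rw [← ofReal_integral_eq_lintegral_ofReal hInt (ae_of_all _ hnn)] at h1
  have hterm : ∀ n : ℕ, 0 ≤ w n * (n : ℝ) ^ (-s) := fun n =>
    mul_nonneg (hw n) (Real.rpow_nonneg (Nat.cast_nonneg n) _)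
  have h2 := ENNReal.hasSum_toReal (f := fun n : ℕ => ENNReal.ofReal (w n * (n : ℝ) ^ (-s)))
    (by rw [h1]; exact ENNReal.ofReal_ne_top)
  have h3 : ∑' n : ℕ, (ENNReal.ofReal (w n * (n : ℝ) ^ (-s))).toReal =
      ∫ x in Set.Ioi (0 : ℝ), summatory w (Real.exp (x / s)) * Real.exp (-x) := by
    rw [← ENNReal.tsum_toReal_eq fun _ => ENNReal.ofReal_ne_top, h1,
      ENNReal.toReal_ofReal (setIntegral_nonneg measurableSet_Ioi fun x _ => hnn x)]
  rw [h3] at h2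
  simpa only [ENNReal.toReal_ofReal (hterm _)] using h2

theorem integrableOn_one_add_rpow_mul_exp_neg {κ : ℝ} (hκ : 0 < κ) :
    IntegrableOn (fun x : ℝ => (1 + x) ^ κ * Real.exp (-x)) (Set.Ioi 0) := by
  have h1 : IntegrableOn (fun x : ℝ => (2 : ℝ) ^ κ * (Real.exp (-x) + Real.exp (-x) * x ^ κ))
      (Set.Ioi 0) := by
    have h2 := Real.GammaIntegral_convergent (s := κ + 1) (by linarith)
    simp only [add_sub_cancel_right] at h2
    exact ((integrableOn_exp_neg_Ioi 0).add h2).const_mul _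
  refine Integrable.mono' h1 (by fun_prop) ?_
  filter_upwards [ae_restrict_mem measurableSet_Ioi] with x hx
  have hx : 0 < x := hx
  rw [Real.norm_of_nonneg (mul_nonneg (Real.rpow_nonneg (by linarith) _) (Real.exp_pos _).le)]
  have : (1 + x) ^ κ ≤ 2 ^ κ * (1 + x ^ κ) := by
    rcases le_total x 1 with h | h
    · calc (1 + x) ^ κ ≤ 2 ^ κ := Real.rpow_le_rpow (by linarith) (by linarith) hκ.le
        _ ≤ 2 ^ κ * (1 + x ^ κ) :=
          le_mul_of_one_le_right (by positivity) (by linarith [Real.rpow_nonneg hx.le κ])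
    · calc (1 + x) ^ κ ≤ (2 * x) ^ κ := Real.rpow_le_rpow (by linarith) (by linarith) hκ.le
        _ = 2 ^ κ * x ^ κ := Real.mul_rpow (by norm_num) hx.le
        _ ≤ 2 ^ κ * (1 + x ^ κ) := by gcongr; linarith
  calc (1 + x) ^ κ * Real.exp (-x) ≤ 2 ^ κ * (1 + x ^ κ) * Real.exp (-x) := by gcongr
    _ = _ := by ring

theorem integrableOn_comp_div_mul_exp_neg {κ K : ℝ} (hκ : 0 < κ) {M : ℝ → ℝ} (hm : Measurable M)
    (hK : ∀ y, 0 ≤ y → |M y| ≤ K * (1 + y) ^ κ) {s : ℝ} (hs : 0 < s) (hs1 : s ≤ 1) :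
    IntegrableOn (fun x => M (x / s) * Real.exp (-x)) (Set.Ioi 0) := by
  refine Integrable.mono' ((integrableOn_one_add_rpow_mul_exp_neg hκ).const_mul (K * s ^ (-κ)))
    (by fun_prop) ?_
  filter_upwards [ae_restrict_mem measurableSet_Ioi] with x hx
  have hx : 0 < x := hx
  have hK0 : 0 ≤ K := by simpa using (abs_nonneg _).trans (hK 0 le_rfl)
  rw [norm_mul, Real.norm_eq_abs, Real.norm_of_nonneg (Real.exp_pos _).le]
  have h1 : (1 + x / s) ^ κ ≤ s ^ (-κ) * (1 + x) ^ κ := by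
    rw [Real.rpow_neg hs.le, ← Real.inv_rpow hs.le, ← Real.mul_rpow (by positivity) (by positivity)]
    refine Real.rpow_le_rpow (by positivity) ?_ hκ.le
    have : 1 ≤ s⁻¹ := (one_le_inv₀ hs).mpr hs1
    rw [div_eq_inv_mul]; linarith
  calc |M (x / s)| * Real.exp (-x) ≤ K * (1 + x / s) ^ κ * Real.exp (-x) := by
        gcongr; exact hK _ (by positivity)
    _ ≤ K * (s ^ (-κ) * (1 + x) ^ κ) * Real.exp (-x) := by gcongr
    _ = _ := by ring

theorem tendsto_div_nhdsGT_zero {x : ℝ} (hx : 0 < x) :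
    Tendsto (fun s : ℝ => x / s) (𝓝[>] 0) atTop := by
  simpa only [div_eq_mul_inv] using tendsto_inv_nhdsGT_zero.const_mul_atTop hx

/-- Abelian theorem: `M y ∼ c y ^ κ` at infinity gives the behaviour of the Laplace transform. -/
theorem tendsto_rpow_mul_integral_comp_div {κ K c : ℝ} (hκ : 0 < κ) {M : ℝ → ℝ}
    (hm : Measurable M) (hK : ∀ y, 0 ≤ y → |M y| ≤ K * (1 + y) ^ κ)
    (hlim : Tendsto (fun y => M y / y ^ κ) atTop (𝓝 c)) :
    Tendsto (fun s : ℝ => s ^ κ * ∫ x in Set.Ioi (0 : ℝ), M (x / s) * Real.exp (-x)) (𝓝[>] 0)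
      (𝓝 (c * Real.Gamma (κ + 1))) := by
  have hK0 : 0 ≤ K := by simpa using (abs_nonneg _).trans (hK 0 le_rfl)
  have h1 : c * Real.Gamma (κ + 1) = ∫ x in Set.Ioi (0 : ℝ), c * x ^ κ * Real.exp (-x) := by
    rw [Real.Gamma_eq_integral (by linarith), ← integral_const_mul]
    simp only [add_sub_cancel_right]
    congr 1; ext x; ring
  simp_rw [← integral_const_mul]
  rw [h1]
  refine tendsto_integral_filter_of_dominated_convergence
    (fun x => K * ((1 + x) ^ κ * Real.exp (-x))) ?_ ?_
    ((integrableOn_one_add_rpow_mul_exp_neg hκ).const_mul K) ?_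
  · exact Eventually.of_forall fun s => by fun_prop
  · filter_upwards [Ioc_mem_nhdsGT (zero_lt_one (α := ℝ))] with s hs
    filter_upwards [ae_restrict_mem measurableSet_Ioi] with x hx
    have hx : 0 < x := hx
    have hs0 : 0 < s := hs.1
    rw [norm_mul, norm_mul, Real.norm_of_nonneg (Real.exp_pos _).le, Real.norm_eq_abs (M _),
      Real.norm_of_nonneg (Real.rpow_nonneg hs0.le _)]
    have h2 : s ^ κ * (1 + x / s) ^ κ ≤ (1 + x) ^ κ := by
      rw [← Real.mul_rpow hs0.le (by positivity)]
      refine Real.rpow_le_rpow (by positivity) ?_ hκ.le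
      rw [mul_add, mul_div_cancel₀ _ hs0.ne']; linarith [hs.2]
    calc s ^ κ * (|M (x / s)| * Real.exp (-x))
        ≤ s ^ κ * (K * (1 + x / s) ^ κ * Real.exp (-x)) := by
          gcongr; exact hK _ (by positivity)
      _ = K * (s ^ κ * (1 + x / s) ^ κ * Real.exp (-x)) := by ring
      _ ≤ _ := by gcongr
  · filter_upwards [ae_restrict_mem measurableSet_Ioi] with x hx
    have hx : 0 < x := hx
    have h2 := ((hlim.comp (tendsto_div_nhdsGT_zero hx)).mul_const (x ^ κ)).mul_const
      (Real.exp (-x))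
    refine h2.congr' ?_
    filter_upwards [self_mem_nhdsWithin] with s hs
    have hs : 0 < s := hs
    have h3 : 0 < s ^ κ := Real.rpow_pos_of_pos hs κ
    have h4 : 0 < x ^ κ := Real.rpow_pos_of_pos hx κ
    simp only [Function.comp, Real.div_rpow hx.le hs.le]
    field_simp

theorem integrableOn_log_mul_exp_neg :
    IntegrableOn (fun x : ℝ => Real.log x * Real.exp (-x)) (Set.Ioi 0) := by
  have h := (mellin_hasDerivAt_of_isBigO_rpow (E := ℂ) (f := fun x => (Real.exp (-x) : ℂ)) (a := 2)
    (b := 0) (s := 1) ?_ ?_ (by norm_num) ?_ (by norm_num)).1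
  · have h2 := Integrable.re h
    refine h2.congr ?_
    filter_upwards [ae_restrict_mem measurableSet_Ioi] with x hx
    rw [sub_self, Complex.cpow_zero, one_smul, Complex.real_smul, ← Complex.ofReal_mul]
    exact Complex.ofReal_re _
  · exact (Continuous.continuousOn (by fun_prop)).locallyIntegrableOn measurableSet_Ioi
  · rw [← Asymptotics.isBigO_norm_left]
    simp_rw [Complex.norm_real, Asymptotics.isBigO_norm_left]
    simpa only [neg_one_mul] using (isLittleO_exp_neg_mul_rpow_atTop zero_lt_one _).isBigO
  · simp_rw [neg_zero, Real.rpow_zero]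
    refine Asymptotics.isBigO_const_of_tendsto (y := (1 : ℂ)) ?_ one_ne_zero
    have : Continuous fun x : ℝ => (Real.exp (-x) : ℂ) := by fun_prop
    have h3 := this.tendsto 0
    simp only [neg_zero, Real.exp_zero, Complex.ofReal_one] at h3
    exact h3.mono_left nhdsWithin_le_nhds

theorem integral_log_mul_exp_neg :
    ∫ x in Set.Ioi (0 : ℝ), Real.log x * Real.exp (-x) = -Real.eulerMascheroniConstant := by
  have h1 := Complex.hasDerivAt_GammaIntegral (s := 1) (by norm_num)
  have h2 : HasDerivAt Complex.Gamma (-Real.eulerMascheroniConstant : ℂ) 1 :=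
    Complex.hasDerivAt_Gamma_one
  have hopen : IsOpen {s : ℂ | 0 < s.re} := Complex.continuous_re.isOpen_preimage _ isOpen_Ioi
  have heq : Complex.Gamma =ᶠ[𝓝 1] Complex.GammaIntegral := by
    filter_upwards [hopen.mem_nhds (by simp : (1 : ℂ) ∈ {s : ℂ | 0 < s.re})] with a ha
    exact Complex.Gamma_eq_integral ha
  have h3 := (h1.congr_of_eventuallyEq heq).unique h2
  simp only [sub_self, Complex.cpow_zero, one_mul] at h3
  apply Complex.ofReal_injective
  rw [Complex.ofReal_neg, ← h3, ← integral_complex_ofReal]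
  simp only [Complex.ofReal_mul]

theorem abs_le_mul_one_add_of_abs_sub_log_le {y κ K : ℝ} (hκ : 0 < κ) {M : ℝ → ℝ}
    (hK0 : ∀ y, 0 ≤ y → y ≤ 1 → |M y| ≤ K) (hK1 : ∀ y, 1 ≤ y → |M y - κ * Real.log y| ≤ K)
    (hy : 0 ≤ y) : |M y| ≤ (K + κ) * (1 + y) ^ (1 : ℝ) := by
  have hK : 0 ≤ K := (abs_nonneg _).trans (hK1 1 le_rfl)
  rw [Real.rpow_one]
  rcases le_total y 1 with h | h
  · nlinarith [hK0 y hy h, mul_nonneg hκ.le hy, mul_nonneg hK hy]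
  · have h1 := abs_le.mp (hK1 y h)
    have h2 : κ * Real.log y ≤ κ * y :=
      mul_le_mul_of_nonneg_left (by linarith [Real.log_le_sub_one_of_pos (zero_lt_one.trans_le h)])
        hκ.le
    have h3 : 0 ≤ κ * Real.log y := mul_nonneg hκ.le (Real.log_nonneg h)
    have h4 := mul_nonneg hK hy
    rw [abs_le]
    constructor <;> linarith

/-- Abelian theorem for functions `M y = κ log y + b + o(1)`. -/
theorem tendsto_integral_comp_div_add_log {κ K b : ℝ} (hκ : 0 < κ) {M : ℝ → ℝ}
    (hm : Measurable M) (hK0 : ∀ y, 0 ≤ y → y ≤ 1 → |M y| ≤ K)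
    (hK1 : ∀ y, 1 ≤ y → |M y - κ * Real.log y| ≤ K)
    (hlim : Tendsto (fun y => M y - κ * Real.log y) atTop (𝓝 b)) :
    Tendsto (fun s : ℝ => (∫ x in Set.Ioi (0 : ℝ), M (x / s) * Real.exp (-x)) + κ * Real.log s)
      (𝓝[>] 0) (𝓝 (b - κ * Real.eulerMascheroniConstant)) := by
  have hK : 0 ≤ K := (abs_nonneg _).trans (hK1 1 le_rfl)
  have hexp := integrableOn_exp_neg_Ioi (0 : ℝ)
  have hdct : Tendsto (fun s : ℝ => ∫ x in Set.Ioi (0 : ℝ),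
      (M (x / s) - κ * Real.log (x / s)) * Real.exp (-x)) (𝓝[>] 0)
      (𝓝 (∫ x in Set.Ioi (0 : ℝ), b * Real.exp (-x))) := by
    refine tendsto_integral_filter_of_dominated_convergence
      (fun x => K * Real.exp (-x) + κ * |Real.log x * Real.exp (-x)|) ?_ ?_
      ((hexp.const_mul K).add (integrableOn_log_mul_exp_neg.abs.const_mul κ)) ?_
    · exact Eventually.of_forall fun s => by fun_prop
    · filter_upwards [Ioc_mem_nhdsGT (zero_lt_one (α := ℝ))] with s hs
      filter_upwards [ae_restrict_mem measurableSet_Ioi] with x hx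
      have hx : 0 < x := hx
      have hs0 : 0 < s := hs.1
      rw [norm_mul, Real.norm_of_nonneg (Real.exp_pos _).le, Real.norm_eq_abs, abs_mul,
        abs_of_pos (Real.exp_pos _), ← mul_assoc, ← add_mul]
      gcongr
      have hl := abs_nonneg (Real.log x)
      rcases le_total (x / s) 1 with h | h
      · have h1 := hK0 (x / s) (by positivity) h
        have h2 : |Real.log (x / s)| ≤ |Real.log x| := by
          have h3 : Real.log (x / s) ≤ 0 := Real.log_nonpos (by positivity) h
          have h4 : Real.log s ≤ 0 := Real.log_nonpos hs0.le hs.2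
          rw [abs_of_nonpos h3, Real.log_div hx.ne' hs0.ne']
          linarith [neg_le_abs (Real.log x)]
        calc |M (x / s) - κ * Real.log (x / s)| ≤ |M (x / s)| + |κ * Real.log (x / s)| :=
              abs_sub _ _
          _ ≤ K + κ * |Real.log x| := by
              rw [abs_mul, abs_of_pos hκ]; gcongr
      · exact (hK1 _ h).trans (by nlinarith)
    · filter_upwards [ae_restrict_mem measurableSet_Ioi] with x hx
      exact (hlim.comp (tendsto_div_nhdsGT_zero hx)).mul_const _
  have hb : ∫ x in Set.Ioi (0 : ℝ), b * Real.exp (-x) = b := by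
    rw [integral_const_mul, integral_exp_neg_Ioi]; simp
  rw [hb] at hdct
  refine (hdct.sub_const (κ * Real.eulerMascheroniConstant)).congr' ?_
  filter_upwards [Ioc_mem_nhdsGT (zero_lt_one (α := ℝ))] with s hs
  have hs0 : 0 < s := hs.1
  have hMint : IntegrableOn (fun x => M (x / s) * Real.exp (-x)) (Set.Ioi 0) :=
    integrableOn_comp_div_mul_exp_neg one_pos hm
      (fun y hy => abs_le_mul_one_add_of_abs_sub_log_le hκ hK0 hK1 hy) hs0 hs.2
  have heq : ∫ x in Set.Ioi (0 : ℝ), (M (x / s) - κ * Real.log (x / s)) * Real.exp (-x) =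
      ∫ x in Set.Ioi (0 : ℝ), (M (x / s) * Real.exp (-x) - κ * (Real.log x * Real.exp (-x)) +
        κ * Real.log s * Real.exp (-x)) := by
    refine setIntegral_congr_fun measurableSet_Ioi fun x hx => ?_
    have hx : 0 < x := hx
    simp only [Real.log_div hx.ne' hs0.ne']
    ring
  have hsub : IntegrableOn
      (fun x => M (x / s) * Real.exp (-x) - κ * (Real.log x * Real.exp (-x))) (Set.Ioi 0) :=
    hMint.sub (integrableOn_log_mul_exp_neg.const_mul κ)
  rw [heq, integral_add hsub (hexp.const_mul _), integral_sub hMint (integrableOn_log_mul_exp_neg.const_mul κ),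
    integral_const_mul, integral_const_mul, integral_log_mul_exp_neg, integral_exp_neg_Ioi]
  simp only [neg_zero, Real.exp_zero]
  ring

end Laplace

section PartialSummation
open MeasureTheory

theorem abs_sum_mul_sub_le {κ D u v : ℝ} (c : ℕ → ℝ) (f f' F : ℝ → ℝ) (hu : 1 < u) (huv : u ≤ v)
    (hc : ∀ t, u ≤ t → |summatory c t - κ * Real.log t| ≤ D)
    (hf : ∀ t ∈ Set.Icc u v, HasDerivAt f (f' t) t) (hf' : ContinuousOn f' (Set.Icc u v))
    (hf'0 : ∀ t ∈ Set.Icc u v, f' t ≤ 0) (hf0 : 0 ≤ f v)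
    (hF : ∀ t ∈ Set.Icc u v, HasDerivAt F (f t / t) t) :
    |∑ k ∈ Finset.Ioc ⌊u⌋₊ ⌊v⌋₊, f k * c k - κ * (F v - F u)| ≤ 2 * D * f u := by
  have hu0 : 0 < u := by linarith
  have hderiv : ∀ t ∈ Set.Icc u v, deriv f t = f' t := fun t ht => (hf t ht).deriv
  have hInt' : IntegrableOn f' (Set.Icc u v) := hf'.integrableOn_Icc
  have hInt : IntegrableOn (deriv f) (Set.Icc u v) :=
    hInt'.congr_fun (fun t ht => (hderiv t ht).symm) measurableSet_Icc
  have habel := sum_mul_eq_sub_sub_integral_mul c hu0.le huv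
    (fun t ht => (hf t ht).differentiableAt) hInt
  have hVint : IntervalIntegrable (fun t => f' t * summatory c t) volume u v := by
    rw [intervalIntegrable_iff_integrableOn_Icc_of_le huv]
    exact integrableOn_mul_sum_Icc c hu0.le hInt'
  have hlogc : ContinuousOn (fun t => f' t * Real.log t) (Set.Icc u v) :=
    hf'.mul (Real.continuousOn_log.mono fun t ht => by
      have : 0 < t := hu0.trans_le ht.1
      exact this.ne')
  have hlint : IntervalIntegrable (fun t => f' t * Real.log t) volume u v :=
    hlogc.intervalIntegrable_of_Icc huv
  have hI1 : ∫ t in Set.Ioc u v, deriv f t * ∑ k ∈ Finset.Icc 0 ⌊t⌋₊, c k =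
      ∫ t in u..v, f' t * summatory c t := by
    rw [intervalIntegral.integral_of_le huv]
    refine setIntegral_congr_fun measurableSet_Ioc fun t ht => ?_
    simp only [hderiv t (Set.Ioc_subset_Icc_self ht), summatory]
  have hI2 : ∫ t in u..v, f' t * Real.log t =
      (f v * Real.log v - F v) - (f u * Real.log u - F u) := by
    refine intervalIntegral.integral_eq_sub_of_hasDerivAt (f := fun t => f t * Real.log t - F t)
      (fun t ht => ?_) hlint
    rw [Set.uIcc_of_le huv] at ht
    have ht0 : 0 < t := hu0.trans_le ht.1
    refine (((hf t ht).mul (Real.hasDerivAt_log ht0.ne')).sub (hF t ht)).congr_deriv ?_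
    ring
  have hI3 : ∫ t in u..v, f' t = f v - f u :=
    intervalIntegral.integral_eq_sub_of_hasDerivAt
      (fun t ht => hf t (by rwa [Set.uIcc_of_le huv] at ht)) (hf'.intervalIntegrable_of_Icc huv)
  have hfe : |∫ t in u..v, f' t * (summatory c t - κ * Real.log t)| ≤ D * (f u - f v) := by
    have := intervalIntegral.norm_integral_le_of_norm_le (μ := volume) huv
      (f := fun t => f' t * (summatory c t - κ * Real.log t)) (g := fun t => -D * f' t)
      (ae_of_all _ fun t ht => by
        rw [norm_mul, Real.norm_eq_abs, Real.norm_eq_abs,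
          abs_of_nonpos (hf'0 t (Set.Ioc_subset_Icc_self ht))]
        nlinarith [hc t ht.1.le, hf'0 t (Set.Ioc_subset_Icc_self ht)])
      ((hf'.intervalIntegrable_of_Icc huv).const_mul (-D))
    rw [intervalIntegral.integral_const_mul, hI3, Real.norm_eq_abs] at this
    linarith
  have hI4 : ∫ t in u..v, f' t * (summatory c t - κ * Real.log t) =
      (∫ t in u..v, f' t * summatory c t) - κ * ∫ t in u..v, f' t * Real.log t := by
    rw [← intervalIntegral.integral_const_mul,
      ← intervalIntegral.integral_sub hVint (hlint.const_mul κ)]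
    congr 1; ext t; ring
  have hfu : f v ≤ f u := by
    have h : ∫ t in u..v, f' t ≤ 0 := by
      rw [intervalIntegral.integral_of_le huv]
      exact setIntegral_nonpos measurableSet_Ioc fun t ht => hf'0 t (Set.Ioc_subset_Icc_self ht)
    linarith
  rw [hI1] at habel
  have heq : ∑ k ∈ Finset.Ioc ⌊u⌋₊ ⌊v⌋₊, f k * c k - κ * (F v - F u) =
      f v * (summatory c v - κ * Real.log v) - f u * (summatory c u - κ * Real.log u) -
        ∫ t in u..v, f' t * (summatory c t - κ * Real.log t) := by
    rw [habel, hI4, hI2]; simp only [summatory]; ring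
  rw [heq]
  have h1 : |f v * (summatory c v - κ * Real.log v)| ≤ f v * D := by
    rw [abs_mul, abs_of_nonneg hf0]; exact mul_le_mul_of_nonneg_left (hc v huv) hf0
  have h2 : |f u * (summatory c u - κ * Real.log u)| ≤ f u * D := by
    rw [abs_mul, abs_of_nonneg (hf0.trans hfu)]
    exact mul_le_mul_of_nonneg_left (hc u le_rfl) (hf0.trans hfu)
  rw [abs_le] at *
  constructor <;> linarith

end PartialSummation

section LogarithmicMean
open Filter Topology

/-- The integrated summatory function `∑_{n ≤ e^y} w n (y - log n)`. -/
noncomputable def logMean (w : ℕ → ℝ) (y : ℝ) : ℝ :=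
  ∑ n ∈ Finset.Icc 0 ⌊Real.exp y⌋₊, w n * (y - Real.log n)

theorem hasDerivWithinAt_logMean (w : ℕ → ℝ) (y : ℝ) :
    HasDerivWithinAt (logMean w) (summatory w (Real.exp y)) (Set.Ici y) y := by
  have h1 : HasDerivAt (fun y' => ∑ n ∈ Finset.Icc 0 ⌊Real.exp y⌋₊, w n * (y' - Real.log n))
      (summatory w (Real.exp y)) y := by
    have : ∀ n ∈ Finset.Icc 0 ⌊Real.exp y⌋₊,
        HasDerivAt (fun y' => w n * (y' - Real.log n)) (w n) y := fun n _ => by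
      simpa using ((hasDerivAt_id y).sub_const (Real.log n)).const_mul (w n)
    exact HasDerivAt.fun_sum this
  refine h1.hasDerivWithinAt.congr_of_eventuallyEq ?_ rfl
  have h2 : ∀ᶠ y' in 𝓝[≥] y, Real.exp y' < ⌊Real.exp y⌋₊ + 1 :=
    nhdsWithin_le_nhds (Real.continuous_exp.continuousAt.eventually_lt_const
      (Nat.lt_floor_add_one _))
  filter_upwards [h2, self_mem_nhdsWithin] with y' h3 h4
  have h5 : ⌊Real.exp y'⌋₊ = ⌊Real.exp y⌋₊ := by
    refine le_antisymm ?_ (Nat.floor_le_floor (Real.exp_le_exp.mpr h4))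
    rw [← Nat.lt_add_one_iff, Nat.floor_lt (Real.exp_pos _).le]
    exact_mod_cast h3
  rw [logMean, h5]

theorem logMean_eq_sum_max {w : ℕ → ℝ} (h0 : w 0 = 0) {y : ℝ} {N : ℕ} (hN : ⌊Real.exp y⌋₊ ≤ N) :
    logMean w y = ∑ n ∈ Finset.Icc 0 N, w n * max (y - Real.log n) 0 := by
  rw [logMean]
  have : Finset.Icc 0 ⌊Real.exp y⌋₊ ⊆ Finset.Icc 0 N := Finset.Icc_subset_Icc le_rfl hN
  rw [← Finset.sum_subset this fun n hn hn' => ?_]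
  · refine Finset.sum_congr rfl fun n hn => ?_
    rcases Nat.eq_zero_or_pos n with rfl | hn0
    · simp [h0]
    rw [Finset.mem_Icc, Nat.le_floor_iff (Real.exp_pos _).le] at hn
    rw [max_eq_left]
    have := (Real.log_le_iff_le_exp (by exact_mod_cast hn0)).mpr hn.2
    linarith
  · rcases Nat.eq_zero_or_pos n with rfl | hn0
    · simp [h0]
    have h1 : ⌊Real.exp y⌋₊ < n := by
      by_contra h; exact hn' (Finset.mem_Icc.mpr ⟨Nat.zero_le _, not_lt.mp h⟩)
    rw [Nat.floor_lt (Real.exp_pos _).le, ← Real.lt_log_iff_exp_lt (by exact_mod_cast hn0)] at h1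
    rw [max_eq_right (by linarith), mul_zero]

theorem continuous_logMean {w : ℕ → ℝ} (h0 : w 0 = 0) : Continuous (logMean w) := by
  refine continuous_iff_continuousAt.mpr fun y => ?_
  have h1 : Continuous fun y' =>
      ∑ n ∈ Finset.Icc 0 ⌊Real.exp (y + 1)⌋₊, w n * max (y' - Real.log n) 0 := by fun_prop
  refine h1.continuousAt.congr ?_
  filter_upwards [Iio_mem_nhds (lt_add_one y)] with y' hy'
  exact (logMean_eq_sum_max h0
    (Nat.floor_le_floor (Real.exp_le_exp.mpr (le_of_lt hy')))).symm

theorem hasDerivWithinAt_logMean_mul_rpow (w : ℕ → ℝ) (k E : ℝ) {y : ℝ} (hy : 0 < y + E) :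
    HasDerivWithinAt (fun y => logMean w y * (y + E) ^ (-k))
      ((y + E) ^ (-k - 1) * ((y + E) * summatory w (Real.exp y) - k * logMean w y)) (Set.Ici y) y := by
  have h1 : HasDerivAt (fun y : ℝ => (y + E) ^ (-k)) (1 * (-k) * (y + E) ^ (-k - 1)) y :=
    ((hasDerivAt_id y).add_const E).rpow_const (Or.inl hy.ne')
  refine ((hasDerivWithinAt_logMean w y).mul h1.hasDerivWithinAt).congr_deriv ?_
  rw [show (y + E) ^ (-k) = (y + E) ^ (-k - 1) * (y + E) by
    rw [← Real.rpow_add_one hy.ne']; ring_nf]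
  ring

theorem continuousOn_logMean_mul_rpow {w : ℕ → ℝ} (h0 : w 0 = 0) (k E : ℝ) {a b : ℝ}
    (ha : 0 < a + E) :
    ContinuousOn (fun y => logMean w y * (y + E) ^ (-k)) (Set.Icc a b) := by
  refine (continuous_logMean h0).continuousOn.mul ?_
  refine ContinuousOn.rpow_const (by fun_prop) fun y hy => Or.inl ?_
  have := hy.1; linarith

theorem logMean_mul_rpow_mono {w : ℕ → ℝ} (h0 : w 0 = 0) {k E a b : ℝ} (ha : 0 < a + E)
    (hab : a ≤ b)
    (h : ∀ y, a ≤ y → k * logMean w y ≤ (y + E) * summatory w (Real.exp y)) :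
    logMean w a * (a + E) ^ (-k) ≤ logMean w b * (b + E) ^ (-k) := by
  refine image_le_of_deriv_right_le_deriv_boundary (f := fun _ => logMean w a * (a + E) ^ (-k))
    (f' := fun _ => 0) (B := fun y => logMean w y * (y + E) ^ (-k)) continuousOn_const
    (fun x _ => hasDerivWithinAt_const _ _ _) le_rfl
    (continuousOn_logMean_mul_rpow h0 k E ha)
    (fun x hx => hasDerivWithinAt_logMean_mul_rpow w k E (by linarith [hx.1]))
    (fun x hx => ?_) (Set.right_mem_Icc.mpr hab)
  have : 0 < x + E := by linarith [hx.1]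
  exact mul_nonneg (Real.rpow_nonneg this.le _) (by linarith [h x hx.1])

theorem logMean_mul_rpow_anti {w : ℕ → ℝ} (h0 : w 0 = 0) {k E a b : ℝ} (ha : 0 < a + E)
    (hab : a ≤ b)
    (h : ∀ y, a ≤ y → (y + E) * summatory w (Real.exp y) ≤ k * logMean w y) :
    logMean w b * (b + E) ^ (-k) ≤ logMean w a * (a + E) ^ (-k) := by
  refine image_le_of_deriv_right_le_deriv_boundary (f := fun y => logMean w y * (y + E) ^ (-k))
    (B' := fun _ => 0) (B := fun _ => logMean w a * (a + E) ^ (-k))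
    (continuousOn_logMean_mul_rpow h0 k E ha)
    (fun x hx => hasDerivWithinAt_logMean_mul_rpow w k E (by linarith [hx.1]))
    le_rfl continuousOn_const (fun x _ => hasDerivWithinAt_const _ _ _)
    (fun x hx => ?_) (Set.right_mem_Icc.mpr hab)
  have : 0 < x + E := by linarith [hx.1]
  exact mul_nonpos_of_nonneg_of_nonpos (Real.rpow_nonneg this.le _) (by linarith [h x hx.1])

/-- A Tauberian step: if the summatory function and its logarithmic mean are proportional up to
a bounded shift, both have the growth of a power of `y`, with explicit error. -/
theorem exists_summatory_bounds {w : ℕ → ℝ} (hw : ∀ n, 0 ≤ w n) (h0 : w 0 = 0) (h1 : w 1 = 1)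
    {k D : ℝ} (hk : 0 < k) (hD : 0 < D)
    (hlo : ∀ y, 0 ≤ y → (y - D) * summatory w (Real.exp y) ≤ k * logMean w y)
    (hup : ∀ y, 0 ≤ y → k * logMean w y ≤ (y + D) * summatory w (Real.exp y)) :
    ∃ c, 0 < c ∧ ∀ y, D < y → c * (y - D) ^ k ≤ (y + D) * summatory w (Real.exp y) ∧
      (y - D) * summatory w (Real.exp y) ≤ c * (y + D) ^ k := by
  set P : ℝ → ℝ := fun y => logMean w y * (y + D) ^ (-k) with hP
  set Q : ℝ → ℝ := fun y => logMean w y * (y + -D) ^ (-k) with hQ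
  have hPmono : ∀ a b, 0 ≤ a → a ≤ b → P a ≤ P b := fun a b ha hab =>
    logMean_mul_rpow_mono h0 (by linarith) hab fun y hy => hup y (ha.trans hy)
  have hQanti : ∀ a b, D < a → a ≤ b → Q b ≤ Q a := fun a b ha hab =>
    logMean_mul_rpow_anti h0 (by linarith) hab fun y hy => by
      simpa only [sub_eq_add_neg] using hlo y (by linarith)
  have hpos : ∀ y, 0 < y → 0 < logMean w y := by
    intro y hy
    have hmem : 1 ∈ Finset.Icc 0 ⌊Real.exp y⌋₊ := by
      rw [Finset.mem_Icc, Nat.le_floor_iff (Real.exp_pos _).le]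
      exact ⟨zero_le_one, by simpa using (Real.one_lt_exp_iff.mpr hy).le⟩
    refine lt_of_lt_of_le ?_ (Finset.single_le_sum (f := fun n => w n * (y - Real.log n))
      (fun n hn => ?_) hmem)
    · simpa [h1] using hy
    · rcases Nat.eq_zero_or_pos n with rfl | hn0
      · simp [h0]
      rw [Finset.mem_Icc, Nat.le_floor_iff (Real.exp_pos _).le] at hn
      exact mul_nonneg (hw n)
        (by linarith [(Real.log_le_iff_le_exp (by exact_mod_cast hn0)).mpr hn.2])
  have hPQ : ∀ a b, 0 ≤ a → D < b → P a ≤ Q b := by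
    intro a b ha hb
    have hm : D < max a b := lt_max_of_lt_right hb
    calc P a ≤ P (max a b) := hPmono _ _ ha (le_max_left _ _)
      _ ≤ Q (max a b) := by
        refine mul_le_mul_of_nonneg_left ?_ (hpos _ (hD.trans hm)).le
        exact Real.rpow_le_rpow_of_nonpos (by linarith) (by linarith) (by linarith)
      _ ≤ Q b := hQanti _ _ hb (le_max_right _ _)
  obtain ⟨l, hl1, hl2⟩ : ∃ l, (∀ a, 0 ≤ a → P a ≤ l) ∧ ∀ b, D < b → l ≤ Q b := by
    refine ⟨sSup (P '' Set.Ici 0), fun a ha => ?_, fun b hb => ?_⟩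
    · exact le_csSup ⟨Q (D + 1), by rintro _ ⟨x, hx, rfl⟩; exact hPQ x _ hx (by linarith)⟩ ⟨a, ha, rfl⟩
    · exact csSup_le ⟨_, 0, Set.mem_Ici.mpr le_rfl, rfl⟩
        (by rintro _ ⟨x, hx, rfl⟩; exact hPQ x b hx hb)
  have hl0 : 0 < l := lt_of_lt_of_le
    (mul_pos (hpos 1 one_pos) (Real.rpow_pos_of_pos (by linarith) _)) (hl1 1 zero_le_one)
  refine ⟨l * k, by positivity, fun y hy => ?_⟩
  have hy0 : 0 < y := hD.trans hy
  have ha := hl1 y hy0.le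
  have hb := hl2 y hy
  simp only [hP, hQ] at ha hb
  rw [Real.rpow_neg (by linarith), ← div_eq_mul_inv, div_le_iff₀
    (Real.rpow_pos_of_pos (by linarith) _)] at ha
  rw [Real.rpow_neg (by linarith), ← div_eq_mul_inv, le_div_iff₀
    (Real.rpow_pos_of_pos (by linarith) _), ← sub_eq_add_neg] at hb
  constructor
  · nlinarith [hup y hy0.le]
  · nlinarith [hlo y hy0.le]

end LogarithmicMean

/-- The hypotheses on the density `g` and the associated function `h`. -/
structure SieveDensity (A₁ A₂ κ L : ℝ) (g h : ℕ → ℝ) : Prop where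
  one_le : 1 ≤ A₁
  pos_A₂ : 0 < A₂
  pos_κ : 0 < κ
  pos_L : 0 < L
  h_one : h 1 = 1
  h_mul : ∀ m n : ℕ, Nat.Coprime m n → h (m * n) = h m * h n
  g_mem : ∀ p : ℕ, p.Prime → 0 ≤ g p ∧ g p < 1
  h_prime : ∀ p : ℕ, p.Prime → h p = g p / (1 - g p)
  g_le : ∀ p : ℕ, p.Prime → g p ≤ 1 - 1 / A₁
  bound : ∀ u v : ℝ, 2 ≤ u → u ≤ v →
    -L ≤ (∑ p ∈ (Finset.Ico ⌈u⌉₊ ⌈v⌉₊).filter Nat.Prime, g p * Real.log p) -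
        κ * Real.log (v / u) ∧
      (∑ p ∈ (Finset.Ico ⌈u⌉₊ ⌈v⌉₊).filter Nat.Prime, g p * Real.log p) -
        κ * Real.log (v / u) ≤ A₂

/-- The weight `g(p) log p` on primes. -/
noncomputable def primeWeight (g : ℕ → ℝ) (k : ℕ) : ℝ :=
  if k.Prime then g k * Real.log k else 0

/-- The weight `μ(n)² h(n)`. -/
noncomputable def sqfreeWeight (h : ℕ → ℝ) (n : ℕ) : ℝ :=
  (ArithmeticFunction.moebius n : ℝ) ^ 2 * h n

theorem sqfreeWeight_of_squarefree (h : ℕ → ℝ) {n : ℕ} (hn : Squarefree n) :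
    sqfreeWeight h n = h n := by
  rw [sqfreeWeight, ← Int.cast_pow, ArithmeticFunction.moebius_sq_eq_one_of_squarefree hn]
  simp

theorem sqfreeWeight_of_not_squarefree (h : ℕ → ℝ) {n : ℕ} (hn : ¬ Squarefree n) :
    sqfreeWeight h n = 0 := by
  rw [sqfreeWeight, ArithmeticFunction.moebius_eq_zero_of_not_squarefree hn]
  simp

theorem sqfreeWeight_zero (h : ℕ → ℝ) : sqfreeWeight h 0 = 0 :=
  sqfreeWeight_of_not_squarefree h not_squarefree_zero

/-- Interchanging a sum over the hyperbola region `k m ≤ N`. -/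
theorem sum_mul_sum_div (c w : ℕ → ℝ) (hc : c 0 = 0) (N : ℕ) :
    ∑ k ∈ Finset.Icc 0 N, c k * ∑ m ∈ Finset.Icc 0 (N / k), w m =
      ∑ k ∈ Finset.Icc 0 N, ∑ m ∈ Finset.Icc 0 N, if k * m ≤ N then c k * w m else 0 := by
  refine Finset.sum_congr rfl fun k _ => ?_
  rcases Nat.eq_zero_or_pos k with rfl | hk
  · simp [hc]
  rw [← Finset.sum_filter, Finset.mul_sum]
  refine Finset.sum_congr ?_ fun _ _ => rfl
  ext m
  simp only [Finset.mem_Icc, Finset.mem_filter, Nat.le_div_iff_mul_le hk, mul_comm m k]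
  constructor
  · rintro ⟨-, h⟩
    exact ⟨⟨Nat.zero_le _, (Nat.le_mul_of_pos_left m hk).trans h⟩, h⟩
  · rintro ⟨-, h⟩
    exact ⟨Nat.zero_le _, h⟩

theorem sum_Icc_dvd (w : ℕ → ℝ) {p : ℕ} (hp : 0 < p) (N : ℕ) :
    ∑ n ∈ Finset.Icc 0 N, (if p ∣ n then w n else 0) =
      ∑ m ∈ Finset.Icc 0 (N / p), w (p * m) := by
  rw [← Finset.sum_filter]
  symm
  refine Finset.sum_nbij' (fun m => p * m) (fun n => n / p) ?_ ?_ ?_ ?_ ?_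
  · intro m hm
    rw [Finset.mem_Icc, Nat.le_div_iff_mul_le hp, mul_comm] at hm
    exact Finset.mem_filter.mpr ⟨Finset.mem_Icc.mpr ⟨Nat.zero_le _, hm.2⟩, dvd_mul_right _ _⟩
  · intro n hn
    rw [Finset.mem_filter, Finset.mem_Icc] at hn
    exact Finset.mem_Icc.mpr ⟨Nat.zero_le _, Nat.div_le_div_right hn.1.2⟩
  · intro m _
    exact Nat.mul_div_cancel_left m hp
  · intro n hn
    exact Nat.mul_div_cancel' (Finset.mem_filter.mp hn).2
  · intro m _
    rfl

theorem primeWeight_zero (g : ℕ → ℝ) : primeWeight g 0 = 0 := by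
  simp [primeWeight, Nat.not_prime_zero]

/-- `∑_{n ≤ N} w(n) log n` decomposed along the prime factors of `n`. -/
theorem sum_sqfreeWeight_mul_log (h : ℕ → ℝ) (N : ℕ) :
    ∑ n ∈ Finset.Icc 0 N, sqfreeWeight h n * Real.log n =
      ∑ p ∈ (Finset.Icc 0 N).filter Nat.Prime,
        Real.log p * ∑ m ∈ Finset.Icc 0 (N / p), sqfreeWeight h (p * m) := by
  have h1 : ∀ n ∈ Finset.Icc 0 N, sqfreeWeight h n * Real.log n =
      ∑ p ∈ (Finset.Icc 0 N).filter Nat.Prime,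
        Real.log p * (if p ∣ n then sqfreeWeight h n else 0) := by
    intro n hn
    by_cases hsq : Squarefree n
    · have hn0 : n ≠ 0 := hsq.ne_zero
      have h2 : Real.log n = ∑ p ∈ n.primeFactors, Real.log p := by
        conv_lhs => rw [← Nat.prod_primeFactors_of_squarefree hsq]
        rw [Nat.cast_prod, Real.log_prod]
        intro p hp
        exact_mod_cast (Nat.prime_of_mem_primeFactors hp).ne_zero
      rw [h2, Finset.mul_sum]
      simp only [mul_ite, mul_zero]
      rw [← Finset.sum_filter]
      refine Finset.sum_congr ?_ fun _ _ => mul_comm _ _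
      ext p
      simp only [Nat.mem_primeFactors, Finset.mem_filter, Finset.mem_Icc] at hn ⊢
      constructor
      · rintro ⟨hp, hd, -⟩
        exact ⟨⟨⟨Nat.zero_le _, (Nat.le_of_dvd (Nat.pos_of_ne_zero hn0) hd).trans hn.2⟩, hp⟩, hd⟩
      · rintro ⟨⟨-, hp⟩, hd⟩
        exact ⟨hp, hd, hn0⟩
    · simp [sqfreeWeight_of_not_squarefree h hsq]
  rw [Finset.sum_congr rfl h1, Finset.sum_comm]
  refine Finset.sum_congr rfl fun p hp => ?_
  rw [← Finset.mul_sum, sum_Icc_dvd _ (Finset.mem_filter.mp hp).2.pos]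

namespace SieveDensity

variable {A₁ A₂ κ L : ℝ} {g h : ℕ → ℝ}

theorem κ_le (S : SieveDensity A₁ A₂ κ L g h) : κ ≤ 5 * L := by
  have h1 := (S.bound 4 5 (by norm_num) (by norm_num)).1
  have h2 : (Finset.Ico ⌈(4 : ℝ)⌉₊ ⌈(5 : ℝ)⌉₊).filter Nat.Prime = ∅ := by
    have h4 : ⌈(4 : ℝ)⌉₊ = 4 := by exact_mod_cast Nat.ceil_natCast (R := ℝ) 4
    have h5 : ⌈(5 : ℝ)⌉₊ = 5 := by exact_mod_cast Nat.ceil_natCast (R := ℝ) 5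
    rw [h4, h5]; decide
  rw [h2, Finset.sum_empty] at h1
  have h3 : 1 / 5 ≤ Real.log (5 / 4) := by
    have := Real.one_sub_inv_le_log_of_pos (x := 5 / 4) (by norm_num)
    norm_num at this ⊢; linarith
  nlinarith [S.pos_κ]

theorem h_nonneg_prime (S : SieveDensity A₁ A₂ κ L g h) {p : ℕ} (hp : p.Prime) : 0 ≤ h p := by
  rw [S.h_prime p hp]
  exact div_nonneg (S.g_mem p hp).1 (by linarith [(S.g_mem p hp).2])

theorem h_le (S : SieveDensity A₁ A₂ κ L g h) {p : ℕ} (hp : p.Prime) : h p ≤ A₁ * g p := by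
  have h1 := S.g_le p hp
  have h2 := S.g_mem p hp
  have h3 : 0 < A₁ := zero_lt_one.trans_le S.one_le
  rw [S.h_prime p hp, div_le_iff₀ (by linarith)]
  have h4 : 1 ≤ A₁ * (1 - g p) := by
    have : A₁ * (1 / A₁) ≤ A₁ * (1 - g p) := mul_le_mul_of_nonneg_left (by linarith) h3.le
    rwa [mul_one_div_cancel h3.ne'] at this
  nlinarith

theorem g_mul_log_le (S : SieveDensity A₁ A₂ κ L g h) {p : ℕ} (hp : p.Prime) :
    g p * Real.log p ≤ A₂ + κ := by
  have hp2 : (2 : ℝ) ≤ p := by exact_mod_cast hp.two_le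
  have h1 := (S.bound p (p + 1) hp2 (by linarith)).2
  have h2 : ⌈(p + 1 : ℝ)⌉₊ = p + 1 := by exact_mod_cast Nat.ceil_natCast (R := ℝ) (p + 1)
  rw [Nat.ceil_natCast, h2, Nat.Ico_succ_singleton, Finset.filter_singleton, if_pos hp,
    Finset.sum_singleton] at h1
  have h3 : Real.log ((p + 1) / p) ≤ 1 := by
    refine (Real.log_le_sub_one_of_pos (by positivity)).trans ?_
    rw [add_div, div_self (by positivity), add_sub_cancel_left, div_le_one (by positivity)]
    linarith
  nlinarith [S.pos_κ]

theorem primeWeight_nonneg (S : SieveDensity A₁ A₂ κ L g h) (k : ℕ) : 0 ≤ primeWeight g k := by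
  unfold primeWeight
  split_ifs with hk
  · exact mul_nonneg (S.g_mem k hk).1 (Real.log_natCast_nonneg k)
  · exact le_rfl

theorem summatory_primeWeight_bounds (S : SieveDensity A₁ A₂ κ L g h) {t : ℝ} (ht : 1 ≤ t) :
    κ * Real.log t - 6 * L ≤ summatory (primeWeight g) t ∧
      summatory (primeWeight g) t ≤ κ * Real.log t + (A₂ + κ) := by
  have hκ := S.pos_κ
  have hlog2 : Real.log 2 ≤ 1 := by
    linarith [Real.log_le_sub_one_of_pos (zero_lt_two (α := ℝ))]
  have ht0 : 0 < t := by linarith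
  have hL := S.κ_le
  have hlogt := Real.log_nonneg ht
  rcases lt_or_ge t 2 with h2 | h2
  · have hf : ⌊t⌋₊ = 1 := by
      rw [Nat.floor_eq_iff (by linarith)]
      norm_num; exact ⟨ht, h2⟩
    have hs : summatory (primeWeight g) t = 0 := by
      rw [summatory, hf]
      refine Finset.sum_eq_zero fun k hk => ?_
      rw [primeWeight, if_neg]
      intro hp
      have := hp.two_le
      have := (Finset.mem_Icc.mp hk).2
      omega
    have h3 : Real.log t ≤ 1 := (Real.log_le_log ht0 h2.le).trans hlog2
    rw [hs]
    constructor <;> nlinarith [S.pos_A₂]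
  · have hb := S.bound 2 (⌊t⌋₊ + 1) le_rfl (h2.trans (Nat.lt_floor_add_one t).le)
    have h3 : ⌈(⌊t⌋₊ + 1 : ℝ)⌉₊ = ⌊t⌋₊ + 1 := by
      exact_mod_cast Nat.ceil_natCast (R := ℝ) (⌊t⌋₊ + 1)
    have h4 : ⌈(2 : ℝ)⌉₊ = 2 := by exact_mod_cast Nat.ceil_natCast (R := ℝ) 2
    have hs : summatory (primeWeight g) t =
        ∑ p ∈ (Finset.Ico 2 (⌊t⌋₊ + 1)).filter Nat.Prime, g p * Real.log p := by
      rw [summatory]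
      simp only [primeWeight]
      rw [← Finset.sum_filter]
      refine Finset.sum_congr ?_ fun _ _ => rfl
      ext p
      simp only [Finset.mem_filter, Finset.mem_Icc, Finset.mem_Ico]
      constructor
      · rintro ⟨⟨-, h⟩, hp⟩
        exact ⟨⟨hp.two_le, by omega⟩, hp⟩
      · rintro ⟨⟨-, h⟩, hp⟩
        exact ⟨⟨Nat.zero_le _, by omega⟩, hp⟩
    rw [h3, h4, ← hs] at hb
    have h5 : Real.log t - Real.log 2 ≤ Real.log ((⌊t⌋₊ + 1) / 2) := by
      rw [← Real.log_div ht0.ne' (by norm_num)]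
      exact Real.log_le_log (by positivity)
        (div_le_div_of_nonneg_right (Nat.lt_floor_add_one t).le (by norm_num))
    have h6 : Real.log ((⌊t⌋₊ + 1) / 2) ≤ Real.log t := by
      refine Real.log_le_log (by positivity) ?_
      rw [div_le_iff₀ (by norm_num)]
      linarith [Nat.floor_le ht0.le]
    constructor <;> nlinarith [hb.1, hb.2]

theorem h_prod (S : SieveDensity A₁ A₂ κ L g h) (s : Finset ℕ) (hs : ∀ p ∈ s, p.Prime) :
    h (∏ p ∈ s, p) = ∏ p ∈ s, h p := by
  induction s using Finset.induction_on with
  | empty => simpa using S.h_one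
  | insert p s hp ih =>
    rw [Finset.prod_insert hp, Finset.prod_insert hp, S.h_mul, ih fun q hq =>
      hs q (Finset.mem_insert_of_mem hq)]
    refine Nat.Coprime.prod_right fun q hq => ?_
    refine (Nat.coprime_primes (hs p (Finset.mem_insert_self _ _))
      (hs q (Finset.mem_insert_of_mem hq))).mpr ?_
    rintro rfl
    exact hp hq

theorem sqfreeWeight_nonneg (S : SieveDensity A₁ A₂ κ L g h) (n : ℕ) : 0 ≤ sqfreeWeight h n := by
  by_cases hn : Squarefree n
  · rw [sqfreeWeight_of_squarefree h hn, ← Nat.prod_primeFactors_of_squarefree hn,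
      S.h_prod _ fun p hp => Nat.prime_of_mem_primeFactors hp]
    exact Finset.prod_nonneg fun p hp => S.h_nonneg_prime (Nat.prime_of_mem_primeFactors hp)
  · rw [sqfreeWeight_of_not_squarefree h hn]

theorem sqfreeWeight_one (S : SieveDensity A₁ A₂ κ L g h) : sqfreeWeight h 1 = 1 := by
  rw [sqfreeWeight_of_squarefree h squarefree_one, S.h_one]

theorem sqfreeWeight_mul (S : SieveDensity A₁ A₂ κ L g h) {m n : ℕ} (hmn : m.Coprime n) :
    sqfreeWeight h (m * n) = sqfreeWeight h m * sqfreeWeight h n := by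
  simp only [sqfreeWeight, S.h_mul m n hmn,
    ArithmeticFunction.isMultiplicative_moebius.map_mul_of_coprime hmn]
  push_cast
  ring

theorem sqfreeWeight_prime_mul (S : SieveDensity A₁ A₂ κ L g h) {p : ℕ} (hp : p.Prime) (m : ℕ) :
    sqfreeWeight h (p * m) = if p ∣ m then 0 else h p * sqfreeWeight h m := by
  split_ifs with hm
  · refine sqfreeWeight_of_not_squarefree h fun hsq => ?_
    have := hsq p (mul_dvd_mul_left p hm)
    exact hp.one_lt.ne' (Nat.isUnit_iff.mp this)
  · rw [S.sqfreeWeight_mul ((Nat.Prime.coprime_iff_not_dvd hp).mpr hm),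
      sqfreeWeight_of_squarefree h hp.prime.squarefree]

/-- The recursion for the sum of the weight over multiples of a prime. -/
theorem sum_multiples_eq (S : SieveDensity A₁ A₂ κ L g h) {p : ℕ} (hp : p.Prime) (M : ℕ) :
    ∑ m ∈ Finset.Icc 0 M, sqfreeWeight h (p * m) =
      g p * ∑ m ∈ Finset.Icc 0 M, sqfreeWeight h m +
        g p * ∑ m ∈ Finset.Ioc (M / p) M, sqfreeWeight h (p * m) := by
  have h1 : ∑ m ∈ Finset.Icc 0 M, sqfreeWeight h (p * m) =
      h p * (∑ m ∈ Finset.Icc 0 M, sqfreeWeight h m -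
        ∑ m ∈ Finset.Icc 0 (M / p), sqfreeWeight h (p * m)) := by
    rw [← sum_Icc_dvd _ hp.pos, ← Finset.sum_sub_distrib, Finset.mul_sum]
    refine Finset.sum_congr rfl fun m _ => ?_
    rw [S.sqfreeWeight_prime_mul hp]
    split_ifs <;> ring
  have h2 : ∑ m ∈ Finset.Icc 0 M, sqfreeWeight h (p * m) =
      ∑ m ∈ Finset.Icc 0 (M / p), sqfreeWeight h (p * m) +
        ∑ m ∈ Finset.Ioc (M / p) M, sqfreeWeight h (p * m) := by
    rw [← Finset.sum_union]
    · refine Finset.sum_congr ?_ fun _ _ => rfl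
      have := Nat.div_le_self M p
      ext m
      simp only [Finset.mem_Icc, Finset.mem_union, Finset.mem_Ioc]
      omega
    · rw [Finset.disjoint_left]
      intro m hm hm'
      simp only [Finset.mem_Icc, Finset.mem_Ioc] at hm hm'
      omega
  have h3 : 1 - g p ≠ 0 := by linarith [(S.g_mem p hp).2]
  rw [S.h_prime p hp, div_mul_eq_mul_div, eq_div_iff h3] at h1
  linear_combination h1 + g p * h2

theorem sum_Ioc_multiples_le (S : SieveDensity A₁ A₂ κ L g h) {p : ℕ} (hp : p.Prime) (M : ℕ) :
    ∑ m ∈ Finset.Ioc (M / p) M, sqfreeWeight h (p * m) ≤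
      h p * ∑ m ∈ Finset.Ioc (M / p) M, sqfreeWeight h m := by
  rw [Finset.mul_sum]
  refine Finset.sum_le_sum fun m _ => ?_
  rw [S.sqfreeWeight_prime_mul hp]
  split_ifs
  · exact mul_nonneg (S.h_nonneg_prime hp) (S.sqfreeWeight_nonneg m)
  · exact le_rfl

theorem sum_primeWeight_mul_h_le (S : SieveDensity A₁ A₂ κ L g h) (N m : ℕ) (hm : 0 < m) :
    ∑ k ∈ Finset.Icc 0 N, (if k * m ≤ N ∧ N < k * k * m then primeWeight g k * h k else 0) ≤
      2 * A₁ * (A₂ + κ) * (κ + 2 * (A₂ + κ)) := by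
  have hA₁ : 0 < A₁ := zero_lt_one.trans_le S.one_le
  have hA : 0 < A₂ + κ := add_pos S.pos_A₂ S.pos_κ
  have hκ := S.pos_κ
  have hm' : (0 : ℝ) < m := by exact_mod_cast hm
  set t : ℝ := N / m with ht
  rcases lt_or_ge t 2 with h2 | h2
  · rw [Finset.sum_eq_zero]
    · positivity
    · intro k _
      split_ifs with hk
      · rw [primeWeight]
        split_ifs with hp
        · exfalso
          have h3 : (k : ℝ) ≤ t := by
            rw [ht, le_div_iff₀ hm']; exact_mod_cast hk.1
          have h4 : (2 : ℝ) ≤ k := by exact_mod_cast hp.two_le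
          linarith
        · simp
      · rfl
  · have ht0 : 0 < t := by linarith
    have hl2 : 1 / 2 ≤ Real.log 2 := by linarith [Real.log_two_gt_d9]
    have hlt : 1 / 2 ≤ Real.log t := hl2.trans (Real.log_le_log (by norm_num) h2)
    have hlt0 : 0 < Real.log t := by linarith
    have hterm : ∀ k ∈ Finset.Icc 0 N,
        (if k * m ≤ N ∧ N < k * k * m then primeWeight g k * h k else 0) ≤
          2 * A₁ * (A₂ + κ) / Real.log t * (if k ≤ ⌊t⌋₊ then primeWeight g k else 0) := by
      intro k _
      have hkt : k * m ≤ N → k ≤ ⌊t⌋₊ := fun hk => by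
        rw [Nat.le_floor_iff ht0.le, ht, le_div_iff₀ hm']; exact_mod_cast hk
      split_ifs with hk hk' hk'
      · have hc := S.primeWeight_nonneg k
        by_cases hp : k.Prime
        · have h3 : h k ≤ 2 * A₁ * (A₂ + κ) / Real.log t := by
            rw [le_div_iff₀ hlt0]
            have h4 : Real.log t ≤ 2 * Real.log k := by
              have hk0 : (0 : ℝ) < k := by exact_mod_cast hp.pos
              rw [← Real.log_rpow hk0]
              refine Real.log_le_log ht0 ?_
              rw [ht, div_le_iff₀ hm']
              have : (N : ℝ) ≤ k * k * m := by exact_mod_cast hk.2.le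
              rw [show (k : ℝ) ^ (2 : ℝ) = k * k by norm_num [sq]]
              exact this
            have h5 := S.g_mul_log_le hp
            have h6 := S.h_le hp
            have h7 : 0 ≤ A₁ * g k := mul_nonneg hA₁.le (S.g_mem k hp).1
            calc h k * Real.log t ≤ A₁ * g k * (2 * Real.log k) :=
                  mul_le_mul h6 h4 hlt0.le h7
              _ = 2 * A₁ * (g k * Real.log k) := by ring
              _ ≤ 2 * A₁ * (A₂ + κ) := by gcongr
          rw [mul_comm]
          exact mul_le_mul_of_nonneg_right h3 hc
        · simp [primeWeight, hp]
      · exact absurd (hkt hk.1) hk'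
      · exact mul_nonneg (by positivity) (S.primeWeight_nonneg k)
      · simp
    refine (Finset.sum_le_sum hterm).trans ?_
    rw [← Finset.mul_sum, ← Finset.sum_filter]
    have hsub : ∑ k ∈ (Finset.Icc 0 N).filter (fun k => k ≤ ⌊t⌋₊), primeWeight g k ≤
        summatory (primeWeight g) t := by
      refine Finset.sum_le_sum_of_subset_of_nonneg ?_ fun k _ _ => S.primeWeight_nonneg k
      intro k hk
      exact Finset.mem_Icc.mpr ⟨Nat.zero_le _, (Finset.mem_filter.mp hk).2⟩
    have hV := (S.summatory_primeWeight_bounds (t := t) (by linarith)).2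
    rw [div_mul_eq_mul_div, div_le_iff₀ hlt0]
    have h8 : summatory (primeWeight g) t ≤ (κ + 2 * (A₂ + κ)) * Real.log t := by nlinarith
    calc _ ≤ 2 * A₁ * (A₂ + κ) * ((κ + 2 * (A₂ + κ)) * Real.log t) := by
          gcongr; exact hsub.trans h8
      _ = _ := by ring

end SieveDensity

namespace SieveDensity

variable {A₁ A₂ κ L : ℝ} {g h : ℕ → ℝ}

theorem sum_log_eq_add (S : SieveDensity A₁ A₂ κ L g h) (N : ℕ) :
    ∑ n ∈ Finset.Icc 0 N, sqfreeWeight h n * Real.log n =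
      ∑ k ∈ Finset.Icc 0 N, primeWeight g k * ∑ m ∈ Finset.Icc 0 (N / k), sqfreeWeight h m +
      ∑ k ∈ Finset.Icc 0 N, primeWeight g k *
        ∑ m ∈ Finset.Ioc (N / k / k) (N / k), sqfreeWeight h (k * m) := by
  rw [sum_sqfreeWeight_mul_log, Finset.sum_filter, ← Finset.sum_add_distrib]
  refine Finset.sum_congr rfl fun k _ => ?_
  unfold primeWeight
  split_ifs with hk
  · rw [S.sum_multiples_eq hk]; ring
  · simp

theorem sum_remainder_nonneg (S : SieveDensity A₁ A₂ κ L g h) (N : ℕ) :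
    0 ≤ ∑ k ∈ Finset.Icc 0 N, primeWeight g k *
        ∑ m ∈ Finset.Ioc (N / k / k) (N / k), sqfreeWeight h (k * m) :=
  Finset.sum_nonneg fun k _ => mul_nonneg (S.primeWeight_nonneg k)
    (Finset.sum_nonneg fun _ _ => S.sqfreeWeight_nonneg _)

theorem sum_remainder_le (S : SieveDensity A₁ A₂ κ L g h) (N : ℕ) :
    ∑ k ∈ Finset.Icc 0 N, primeWeight g k *
        ∑ m ∈ Finset.Ioc (N / k / k) (N / k), sqfreeWeight h (k * m) ≤
      2 * A₁ * (A₂ + κ) * (κ + 2 * (A₂ + κ)) * ∑ m ∈ Finset.Icc 0 N, sqfreeWeight h m := by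
  have h1 : ∀ k ∈ Finset.Icc 0 N, primeWeight g k *
        ∑ m ∈ Finset.Ioc (N / k / k) (N / k), sqfreeWeight h (k * m) ≤
      ∑ m ∈ Finset.Icc 0 N, sqfreeWeight h m *
        (if k * m ≤ N ∧ N < k * k * m then primeWeight g k * h k else 0) := by
    intro k _
    by_cases hk : k.Prime
    · refine (mul_le_mul_of_nonneg_left (S.sum_Ioc_multiples_le hk _)
        (S.primeWeight_nonneg k)).trans (le_of_eq ?_)
      rw [← mul_assoc, Finset.mul_sum]
      simp only [mul_ite, mul_zero]
      rw [← Finset.sum_filter]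
      refine Finset.sum_congr ?_ fun _ _ => mul_comm _ _
      ext m
      simp only [Finset.mem_Ioc, Finset.mem_filter, Finset.mem_Icc, Nat.div_div_eq_div_mul,
        Nat.div_lt_iff_lt_mul (Nat.mul_pos hk.pos hk.pos), Nat.le_div_iff_mul_le hk.pos]
      rw [mul_comm m k, mul_comm m (k * k)]
      constructor
      · rintro ⟨ha, hb⟩
        exact ⟨⟨Nat.zero_le _, (Nat.le_mul_of_pos_left m hk.pos).trans hb⟩, hb, ha⟩
      · rintro ⟨-, hb, ha⟩
        exact ⟨ha, hb⟩
    · simp [primeWeight, hk]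
  refine (Finset.sum_le_sum h1).trans ?_
  rw [Finset.sum_comm, Finset.mul_sum]
  refine Finset.sum_le_sum fun m _ => ?_
  rw [← Finset.mul_sum, mul_comm]
  rcases Nat.eq_zero_or_pos m with rfl | hm
  · simp [sqfreeWeight_zero]
  · exact mul_le_mul_of_nonneg_right (S.sum_primeWeight_mul_h_le N m hm) (S.sqfreeWeight_nonneg m)

theorem sum_primeWeight_mul_sum (g h : ℕ → ℝ) {x : ℝ} :
    ∑ k ∈ Finset.Icc 0 ⌊x⌋₊, primeWeight g k *
        ∑ m ∈ Finset.Icc 0 (⌊x⌋₊ / k), sqfreeWeight h m =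
      ∑ m ∈ Finset.Icc 0 ⌊x⌋₊, sqfreeWeight h m * summatory (primeWeight g) (x / m) := by
  have h1 : ∀ m : ℕ, summatory (primeWeight g) (x / m) =
      ∑ k ∈ Finset.Icc 0 (⌊x⌋₊ / m), primeWeight g k := fun m => by
    rw [summatory, Nat.floor_div_natCast]
  simp_rw [h1]
  rw [sum_mul_sum_div _ _ (primeWeight_zero g), sum_mul_sum_div _ _ (sqfreeWeight_zero h),
    Finset.sum_comm]
  refine Finset.sum_congr rfl fun m _ => Finset.sum_congr rfl fun k _ => ?_
  rw [mul_comm k m, mul_comm (primeWeight g k)]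

theorem logMean_eq (h : ℕ → ℝ) (y : ℝ) :
    logMean (sqfreeWeight h) y = y * summatory (sqfreeWeight h) (Real.exp y) -
      ∑ n ∈ Finset.Icc 0 ⌊Real.exp y⌋₊, sqfreeWeight h n * Real.log n := by
  rw [logMean, summatory, Finset.mul_sum, ← Finset.sum_sub_distrib]
  exact Finset.sum_congr rfl fun n _ => by ring

theorem sum_mul_summatory_bounds (S : SieveDensity A₁ A₂ κ L g h) (y : ℝ) :
    κ * logMean (sqfreeWeight h) y - 6 * L * summatory (sqfreeWeight h) (Real.exp y) ≤
      ∑ m ∈ Finset.Icc 0 ⌊Real.exp y⌋₊,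
        sqfreeWeight h m * summatory (primeWeight g) (Real.exp y / m) ∧
    ∑ m ∈ Finset.Icc 0 ⌊Real.exp y⌋₊,
        sqfreeWeight h m * summatory (primeWeight g) (Real.exp y / m) ≤
      κ * logMean (sqfreeWeight h) y + (A₂ + κ) * summatory (sqfreeWeight h) (Real.exp y) := by
  have key : ∀ m ∈ Finset.Icc 0 ⌊Real.exp y⌋₊,
      κ * (sqfreeWeight h m * (y - Real.log m)) - 6 * L * sqfreeWeight h m ≤
        sqfreeWeight h m * summatory (primeWeight g) (Real.exp y / m) ∧
      sqfreeWeight h m * summatory (primeWeight g) (Real.exp y / m) ≤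
        κ * (sqfreeWeight h m * (y - Real.log m)) + (A₂ + κ) * sqfreeWeight h m := by
    intro m hm
    rcases Nat.eq_zero_or_pos m with rfl | hm0
    · simp [sqfreeWeight_zero]
    have hm0' : (0 : ℝ) < m := by exact_mod_cast hm0
    rw [Finset.mem_Icc, Nat.le_floor_iff (Real.exp_pos _).le] at hm
    have hb := S.summatory_primeWeight_bounds (t := Real.exp y / m)
      (by rw [le_div_iff₀ hm0']; linarith [hm.2])
    rw [Real.log_div (Real.exp_pos _).ne' hm0'.ne', Real.log_exp] at hb
    have hw := S.sqfreeWeight_nonneg m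
    constructor
    · nlinarith [mul_le_mul_of_nonneg_left hb.1 hw]
    · nlinarith [mul_le_mul_of_nonneg_left hb.2 hw]
  rw [logMean, summatory, Finset.mul_sum, Finset.mul_sum, Finset.mul_sum, ← Finset.sum_sub_distrib,
    ← Finset.sum_add_distrib]
  exact ⟨Finset.sum_le_sum fun m hm => (key m hm).1, Finset.sum_le_sum fun m hm => (key m hm).2⟩

/-- The summatory function of `μ² h` is proportional to its logarithmic mean up to `O(L)`. -/
theorem logMean_bounds (S : SieveDensity A₁ A₂ κ L g h) (y : ℝ) :
    (κ + 1) * logMean (sqfreeWeight h) y ≤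
        (y + 6 * L) * summatory (sqfreeWeight h) (Real.exp y) ∧
      (y - (A₂ + κ + 2 * A₁ * (A₂ + κ) * (κ + 2 * (A₂ + κ)))) *
        summatory (sqfreeWeight h) (Real.exp y) ≤ (κ + 1) * logMean (sqfreeWeight h) y := by
  have h1 := S.sum_log_eq_add ⌊Real.exp y⌋₊
  rw [sum_primeWeight_mul_sum] at h1
  have h2 := S.sum_mul_summatory_bounds y
  have h3 := S.sum_remainder_nonneg ⌊Real.exp y⌋₊
  have h4 := S.sum_remainder_le ⌊Real.exp y⌋₊
  have h5 := logMean_eq h y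
  have h6 : ∑ m ∈ Finset.Icc 0 ⌊Real.exp y⌋₊, sqfreeWeight h m =
    summatory (sqfreeWeight h) (Real.exp y) := rfl
  rw [h6] at h4
  constructor <;> linarith [h2.1, h2.2]

/-- The growth of the summatory function of `μ² h`. -/
theorem exists_summatory_sqfreeWeight_bounds (S : SieveDensity A₁ A₂ κ L g h) {D : ℝ}
    (hD1 : 6 * L ≤ D) (hD2 : A₂ + κ + 2 * A₁ * (A₂ + κ) * (κ + 2 * (A₂ + κ)) ≤ D) :
    ∃ c, 0 < c ∧ ∀ y, D < y →
      c * (y - D) ^ (κ + 1) ≤ (y + D) * summatory (sqfreeWeight h) (Real.exp y) ∧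
      (y - D) * summatory (sqfreeWeight h) (Real.exp y) ≤ c * (y + D) ^ (κ + 1) := by
  have hnn : ∀ y, 0 ≤ summatory (sqfreeWeight h) (Real.exp y) := fun y =>
    Finset.sum_nonneg fun n _ => S.sqfreeWeight_nonneg n
  refine exists_summatory_bounds S.sqfreeWeight_nonneg (sqfreeWeight_zero h) S.sqfreeWeight_one
    (by linarith [S.pos_κ]) (by linarith [S.pos_L]) (fun y _ => ?_) (fun y _ => ?_)
  · nlinarith [(S.logMean_bounds y).2, hnn y]
  · nlinarith [(S.logMean_bounds y).1, hnn y]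

end SieveDensity

theorem sum_powerset_prod_mul_sum (P : Finset ℕ) (a b : ℕ → ℝ) (ha : ∀ p ∈ P, 0 ≤ a p) :
    ∑ t ∈ P.powerset, (∏ p ∈ t, a p) * ∑ p ∈ t, b p =
      (∏ p ∈ P, (1 + a p)) * ∑ p ∈ P, a p / (1 + a p) * b p := by
  induction P using Finset.induction_on with
  | empty => simp
  | insert q P hq ih =>
    have ih := ih fun p hp => ha p (Finset.mem_insert_of_mem hp)
    have h1 : ∑ t ∈ P.powerset, (∏ p ∈ insert q t, a p) * ∑ p ∈ insert q t, b p =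
        a q * (b q * ∑ t ∈ P.powerset, ∏ p ∈ t, a p) +
          a q * ∑ t ∈ P.powerset, (∏ p ∈ t, a p) * ∑ p ∈ t, b p := by
      rw [Finset.mul_sum, Finset.mul_sum, Finset.mul_sum, ← Finset.sum_add_distrib]
      refine Finset.sum_congr rfl fun t ht => ?_
      have hqt : q ∉ t := fun h => hq (Finset.mem_powerset.mp ht h)
      rw [Finset.prod_insert hqt, Finset.sum_insert hqt]
      ring
    have h2 : 1 + a q ≠ 0 := by linarith [ha q (Finset.mem_insert_self _ _)]
    rw [Finset.sum_powerset_insert hq, h1, ih, ← Finset.prod_one_add, Finset.prod_insert hq,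
      Finset.sum_insert hq]
    field_simp
    ring

namespace SieveDensity

variable {A₁ A₂ κ L : ℝ} {g h : ℕ → ℝ}

theorem one_add_h (S : SieveDensity A₁ A₂ κ L g h) {p : ℕ} (hp : p.Prime) :
    1 + h p = (1 - g p)⁻¹ := by
  have : 1 - g p ≠ 0 := by linarith [(S.g_mem p hp).2]
  rw [S.h_prime p hp]; field_simp; ring

theorem one_sub_pos (S : SieveDensity A₁ A₂ κ L g h) {p : ℕ} (hp : p.Prime) : 0 < 1 - g p := by
  linarith [(S.g_mem p hp).2]

theorem g_le_neg_log (S : SieveDensity A₁ A₂ κ L g h) {p : ℕ} (hp : p.Prime) :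
    g p ≤ -Real.log (1 - g p) := by
  linarith [Real.log_le_sub_one_of_pos (S.one_sub_pos hp)]

theorem neg_log_le_h (S : SieveDensity A₁ A₂ κ L g h) {p : ℕ} (hp : p.Prime) :
    -Real.log (1 - g p) ≤ h p := by
  rw [← Real.log_inv, ← S.one_add_h hp]
  have h1 := S.h_nonneg_prime hp
  linarith [Real.log_le_sub_one_of_pos (by linarith : 0 < 1 + h p)]

theorem one_le_summatory (S : SieveDensity A₁ A₂ κ L g h) {z : ℝ} (hz : 1 ≤ z) :
    1 ≤ summatory (sqfreeWeight h) z := by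
  have hmem : 1 ∈ Finset.Icc 0 ⌊z⌋₊ := by
    rw [Finset.mem_Icc, Nat.le_floor_iff (by linarith)]
    exact ⟨zero_le_one, by simpa using hz⟩
  calc (1 : ℝ) = sqfreeWeight h 1 := S.sqfreeWeight_one.symm
    _ ≤ _ := Finset.single_le_sum (f := sqfreeWeight h) (fun n _ => S.sqfreeWeight_nonneg n) hmem

theorem prod_pos (S : SieveDensity A₁ A₂ κ L g h) (N : ℕ) :
    0 < ∏ p ∈ (Finset.range N).filter Nat.Prime, (1 - g p) :=
  Finset.prod_pos fun _ hp => S.one_sub_pos (Finset.mem_filter.mp hp).2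

/-- Comparison of the products `W` at two points, from the upper bound hypothesis only. -/
theorem prod_le_exp_mul_prod (S : SieveDensity A₁ A₂ κ L g h) {u z : ℝ} (hu : 2 ≤ u)
    (huz : u ≤ z) :
    ∏ p ∈ (Finset.range ⌈u⌉₊).filter Nat.Prime, (1 - g p) ≤
      Real.exp (A₁ * ((κ * Real.log (z / u) + A₂) / Real.log u)) *
        ∏ p ∈ (Finset.range ⌈z⌉₊).filter Nat.Prime, (1 - g p) := by
  have hlu : 0 < Real.log u := Real.log_pos (by linarith)
  have hA₁ : 0 < A₁ := zero_lt_one.trans_le S.one_le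
  have hsplit : ∏ p ∈ (Finset.range ⌈z⌉₊).filter Nat.Prime, (1 - g p) =
      (∏ p ∈ (Finset.range ⌈u⌉₊).filter Nat.Prime, (1 - g p)) *
        ∏ p ∈ (Finset.Ico ⌈u⌉₊ ⌈z⌉₊).filter Nat.Prime, (1 - g p) := by
    rw [← Finset.prod_union]
    · refine Finset.prod_congr ?_ fun _ _ => rfl
      have := Nat.ceil_le_ceil huz
      ext p
      simp only [Finset.mem_filter, Finset.mem_range, Finset.mem_union, Finset.mem_Ico]
      constructor
      · rintro ⟨h1, h2⟩
        rcases lt_or_ge p ⌈u⌉₊ with h | h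
        · exact Or.inl ⟨h, h2⟩
        · exact Or.inr ⟨⟨h, h1⟩, h2⟩
      · rintro (⟨h1, h2⟩ | ⟨h1, h2⟩)
        · exact ⟨by omega, h2⟩
        · exact ⟨h1.2, h2⟩
    · rw [Finset.disjoint_left]
      intro p hp hp'
      simp only [Finset.mem_filter, Finset.mem_range, Finset.mem_Ico] at hp hp'
      omega
  have hsum : ∑ p ∈ (Finset.Ico ⌈u⌉₊ ⌈z⌉₊).filter Nat.Prime, g p ≤
      (κ * Real.log (z / u) + A₂) / Real.log u := by
    rw [le_div_iff₀ hlu, Finset.sum_mul]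
    refine le_trans (Finset.sum_le_sum fun p hp => ?_)
      (by linarith [(S.bound u z hu huz).2] :
        ∑ p ∈ (Finset.Ico ⌈u⌉₊ ⌈z⌉₊).filter Nat.Prime, g p * Real.log p ≤ _)
    rw [Finset.mem_filter, Finset.mem_Ico] at hp
    exact mul_le_mul_of_nonneg_left
      (Real.log_le_log (by linarith) (Nat.ceil_le.mp hp.1.1)) (S.g_mem p hp.2).1
  have hprod : Real.exp (-(A₁ * ((κ * Real.log (z / u) + A₂) / Real.log u))) ≤
      ∏ p ∈ (Finset.Ico ⌈u⌉₊ ⌈z⌉₊).filter Nat.Prime, (1 - g p) := by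
    calc Real.exp (-(A₁ * ((κ * Real.log (z / u) + A₂) / Real.log u)))
        ≤ Real.exp (∑ p ∈ (Finset.Ico ⌈u⌉₊ ⌈z⌉₊).filter Nat.Prime, -(A₁ * g p)) := by
          rw [Finset.sum_neg_distrib, ← Finset.mul_sum]
          gcongr
      _ = ∏ p ∈ (Finset.Ico ⌈u⌉₊ ⌈z⌉₊).filter Nat.Prime, Real.exp (-(A₁ * g p)) :=
          Real.exp_sum _ _
      _ ≤ _ := by
          refine Finset.prod_le_prod (fun _ _ => (Real.exp_pos _).le) fun p hp => ?_
          have hp := (Finset.mem_filter.mp hp).2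
          rw [← Real.le_log_iff_exp_le (S.one_sub_pos hp)]
          linarith [S.neg_log_le_h hp, S.h_le hp]
  rw [hsplit]
  have hW := S.prod_pos ⌈u⌉₊
  rw [Real.exp_neg, inv_le_iff_one_le_mul₀ (Real.exp_pos _)] at hprod
  nlinarith

/-- A Markov-inequality lower bound for the summatory function of `μ² h`. -/
theorem one_le_two_mul_summatory_mul_prod (S : SieveDensity A₁ A₂ κ L g h) {u z : ℝ}
    (hu : 2 ≤ u) (hz : 1 < z) (huz : 2 * (κ * Real.log u + A₂) ≤ Real.log z) :
    1 ≤ 2 * summatory (sqfreeWeight h) z *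
      ∏ p ∈ (Finset.range ⌈u⌉₊).filter Nat.Prime, (1 - g p) := by
  set P := (Finset.range ⌈u⌉₊).filter Nat.Prime with hP
  have hprime : ∀ p ∈ P, p.Prime := fun p hp => (Finset.mem_filter.mp hp).2
  have hlz : 0 < Real.log z := Real.log_pos hz
  set Z := ∏ p ∈ P, (1 + h p) with hZ
  have hZ0 : 0 < Z := Finset.prod_pos fun p hp => by linarith [S.h_nonneg_prime (hprime p hp)]
  have hZW : Z * ∏ p ∈ P, (1 - g p) = 1 := by
    rw [hZ, ← Finset.prod_mul_distrib]
    refine Finset.prod_eq_one fun p hp => ?_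
    rw [S.one_add_h (hprime p hp), inv_mul_cancel₀ (S.one_sub_pos (hprime p hp)).ne']
  have hlogsum : ∑ p ∈ P, h p / (1 + h p) * Real.log p ≤ Real.log z / 2 := by
    have h1 : ∑ p ∈ P, h p / (1 + h p) * Real.log p =
        ∑ p ∈ (Finset.Ico ⌈(2 : ℝ)⌉₊ ⌈u⌉₊).filter Nat.Prime, g p * Real.log p := by
      have h4 : ⌈(2 : ℝ)⌉₊ = 2 := by exact_mod_cast Nat.ceil_natCast (R := ℝ) 2
      rw [h4]
      refine Finset.sum_congr ?_ fun p hp => ?_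
      · ext p
        simp only [hP, Finset.mem_filter, Finset.mem_range, Finset.mem_Ico]
        exact ⟨fun h => ⟨⟨h.2.two_le, h.1⟩, h.2⟩, fun h => ⟨h.1.2, h.2⟩⟩
      · have hp := (Finset.mem_filter.mp hp).2
        rw [S.one_add_h hp, S.h_prime p hp]
        have := (S.one_sub_pos hp).ne'
        field_simp
    have h2 := (S.bound 2 u le_rfl hu).2
    have h3 : Real.log (u / 2) ≤ Real.log u := Real.log_le_log (by linarith) (by linarith)
    rw [h1]
    nlinarith [S.pos_κ]
  have hnn : ∀ t ∈ P.powerset, 0 ≤ ∏ p ∈ t, h p := fun t ht =>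
    Finset.prod_nonneg fun p hp => S.h_nonneg_prime (hprime p (Finset.mem_powerset.mp ht hp))
  have hsmall : ∑ t ∈ P.powerset.filter (fun t => ∏ p ∈ t, p ≤ ⌊z⌋₊), ∏ p ∈ t, h p ≤
      summatory (sqfreeWeight h) z := by
    have hval : ∀ t ∈ P.powerset.filter (fun t => ∏ p ∈ t, p ≤ ⌊z⌋₊),
        ∏ p ∈ t, h p = sqfreeWeight h (∏ p ∈ t, p) := by
      intro t ht
      have htP := fun p hp => hprime p
        (Finset.mem_powerset.mp (Finset.mem_filter.mp ht).1 hp)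
      rw [sqfreeWeight_of_squarefree, S.h_prod t htP]
      refine Finset.squarefree_prod_of_pairwise_isCoprime (fun p hp q hq hpq => ?_)
        fun p hp => (htP p hp).prime.squarefree
      exact Nat.coprime_iff_isRelPrime.mp ((Nat.coprime_primes (htP p hp) (htP q hq)).mpr hpq)
    have hinj : Set.InjOn (fun t : Finset ℕ => ∏ p ∈ t, p)
        (P.powerset.filter (fun t => ∏ p ∈ t, p ≤ ⌊z⌋₊) : Finset (Finset ℕ)) := by
      intro s hs t ht hst
      have hs' := fun p hp => hprime p (Finset.mem_powerset.mp (Finset.mem_filter.mp hs).1 hp)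
      have ht' := fun p hp => hprime p (Finset.mem_powerset.mp (Finset.mem_filter.mp ht).1 hp)
      rw [← Nat.primeFactors_prod hs', ← Nat.primeFactors_prod ht']
      exact congrArg Nat.primeFactors hst
    rw [Finset.sum_congr rfl hval, ← Finset.sum_image (f := sqfreeWeight h) hinj]
    refine Finset.sum_le_sum_of_subset_of_nonneg ?_ fun n _ _ => S.sqfreeWeight_nonneg n
    intro n hn
    obtain ⟨t, ht, rfl⟩ := Finset.mem_image.mp hn
    exact Finset.mem_Icc.mpr ⟨Nat.zero_le _, (Finset.mem_filter.mp ht).2⟩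
  have hpoint : ∀ t ∈ P.powerset, ∏ p ∈ t, h p ≤
      (if ∏ p ∈ t, p ≤ ⌊z⌋₊ then ∏ p ∈ t, h p else 0) +
        ((∏ p ∈ t, h p) * ∑ p ∈ t, Real.log p) / Real.log z := by
    intro t ht
    have htP := fun p hp => hprime p (Finset.mem_powerset.mp ht hp)
    have hlog : ∑ p ∈ t, Real.log p = Real.log ((∏ p ∈ t, p : ℕ) : ℝ) := by
      rw [Nat.cast_prod, Real.log_prod]
      intro p hp
      exact_mod_cast (htP p hp).ne_zero
    split_ifs with hle
    · have : 0 ≤ ∑ p ∈ t, Real.log p := hlog ▸ Real.log_natCast_nonneg _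
      have := div_nonneg (mul_nonneg (hnn t ht) this) hlz.le
      linarith
    · rw [zero_add, le_div_iff₀ hlz, hlog]
      refine mul_le_mul_of_nonneg_left (Real.log_le_log (by linarith) ?_) (hnn t ht)
      exact (Nat.lt_of_floor_lt (not_le.mp hle)).le
  have hmain : Z ≤ summatory (sqfreeWeight h) z + Z / 2 := by
    calc Z = ∑ t ∈ P.powerset, ∏ p ∈ t, h p := Finset.prod_one_add P
      _ ≤ _ := Finset.sum_le_sum hpoint
      _ = (∑ t ∈ P.powerset.filter (fun t => ∏ p ∈ t, p ≤ ⌊z⌋₊), ∏ p ∈ t, h p) +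
          Z * (∑ p ∈ P, h p / (1 + h p) * Real.log p) / Real.log z := by
        rw [Finset.sum_add_distrib, ← Finset.sum_filter, ← Finset.sum_div,
          sum_powerset_prod_mul_sum P h _ fun p hp => S.h_nonneg_prime (hprime p hp)]
      _ ≤ summatory (sqfreeWeight h) z + Z * (Real.log z / 2) / Real.log z := by
        gcongr
      _ = _ := by field_simp
  have hW := S.prod_pos ⌈u⌉₊
  rw [← hP] at hW
  nlinarith

/-- `1 / H(z) ≪ W(z)`, with a constant depending only on `A₁`, `A₂`, `κ`. -/
theorem one_le_const_mul_summatory_mul_prod (S : SieveDensity A₁ A₂ κ L g h) {z : ℝ}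
    (hz : 2 ≤ z) :
    1 ≤ (2 * Real.exp (A₁ * (κ * (4 * (κ + 1)) + A₂)) +
        Real.exp (A₁ * ((κ * (4 * A₂ + 4 * (κ + 1)) + A₂) / Real.log 2))) *
      (summatory (sqfreeWeight h) z * ∏ p ∈ (Finset.range ⌈z⌉₊).filter Nat.Prime, (1 - g p)) := by
  have hκ := S.pos_κ
  have hA₂ := S.pos_A₂
  have hA₁ : 0 < A₁ := zero_lt_one.trans_le S.one_le
  have hz0 : 0 < z := by linarith
  have hG := S.one_le_summatory (z := z) (by linarith)
  have hW := S.prod_pos ⌈z⌉₊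
  set G := summatory (sqfreeWeight h) z
  set W := ∏ p ∈ (Finset.range ⌈z⌉₊).filter Nat.Prime, (1 - g p)
  set y := Real.log z with hy
  have hGW : 0 < G * W := by positivity
  rw [add_mul]
  rcases le_total (4 * A₂ + 4 * (κ + 1)) y with h1 | h1
  · set u := Real.exp (y / (4 * (κ + 1))) with hu
    have hlu : Real.log u = y / (4 * (κ + 1)) := Real.log_exp _
    have hr : 1 ≤ y / (4 * (κ + 1)) := by rw [le_div_iff₀ (by positivity)]; linarith
    have hu2 : 2 ≤ u := by linarith [Real.add_one_le_exp (y / (4 * (κ + 1)))]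
    have hy0 : 0 < y := by linarith
    have huy : y / (4 * (κ + 1)) ≤ y := div_le_self hy0.le (by linarith)
    have huz : u ≤ z := by rw [hu, ← Real.le_log_iff_exp_le hz0]; exact huy
    have hm := S.one_le_two_mul_summatory_mul_prod hu2 (by linarith : 1 < z) (by
      rw [hlu]
      have : κ * (y / (4 * (κ + 1))) ≤ y / 4 := by
        rw [mul_div_assoc', div_le_div_iff₀ (by positivity) (by norm_num)]
        nlinarith
      linarith)
    have hp := S.prod_le_exp_mul_prod hu2 huz
    have he : A₁ * ((κ * Real.log (z / u) + A₂) / Real.log u) ≤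
        A₁ * (κ * (4 * (κ + 1)) + A₂) := by
      gcongr
      rw [hlu, div_le_iff₀ (by linarith), Real.log_div hz0.ne' (Real.exp_pos _).ne', hlu]
      have : κ * (4 * (κ + 1)) * (y / (4 * (κ + 1))) = κ * y := by field_simp
      nlinarith
    have he' := Real.exp_le_exp.mpr he
    have hfin : ∏ p ∈ (Finset.range ⌈u⌉₊).filter Nat.Prime, (1 - g p) ≤
        Real.exp (A₁ * (κ * (4 * (κ + 1)) + A₂)) * W :=
      hp.trans (mul_le_mul_of_nonneg_right he' hW.le)
    have : 1 ≤ 2 * G * (Real.exp (A₁ * (κ * (4 * (κ + 1)) + A₂)) * W) :=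
      hm.trans (mul_le_mul_of_nonneg_left hfin (by positivity))
    have h3 : 0 < Real.exp (A₁ * ((κ * (4 * A₂ + 4 * (κ + 1)) + A₂) / Real.log 2)) * (G * W) := by
      positivity
    linarith
  · have hp := S.prod_le_exp_mul_prod le_rfl hz
    have h2 : ∏ p ∈ (Finset.range ⌈(2 : ℝ)⌉₊).filter Nat.Prime, (1 - g p) = 1 := by
      refine Finset.prod_eq_one fun p hp => ?_
      have h4 : ⌈(2 : ℝ)⌉₊ = 2 := by exact_mod_cast Nat.ceil_natCast (R := ℝ) 2
      rw [h4, Finset.mem_filter, Finset.mem_range] at hp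
      exact absurd hp.2.two_le (by omega)
    rw [h2] at hp
    have hl2 : 0 < Real.log 2 := Real.log_pos (by norm_num)
    have he : A₁ * ((κ * Real.log (z / 2) + A₂) / Real.log 2) ≤
        A₁ * ((κ * (4 * A₂ + 4 * (κ + 1)) + A₂) / Real.log 2) := by
      gcongr
      exact (Real.log_le_log (by positivity) (by linarith)).trans h1
    have he' := mul_le_mul_of_nonneg_right (Real.exp_le_exp.mpr he) hW.le
    have h5 : W ≤ G * W := le_mul_of_one_le_left hW.le hG
    have h6 := mul_le_mul_of_nonneg_left h5
      (Real.exp_pos (A₁ * ((κ * (4 * A₂ + 4 * (κ + 1)) + A₂) / Real.log 2))).le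
    have h7 : 0 < 2 * Real.exp (A₁ * (κ * (4 * (κ + 1)) + A₂)) * (G * W) := by positivity
    linarith

end SieveDensity

/-- The weight `-log (1 - g(p))` on primes. -/
noncomputable def logFactor (g : ℕ → ℝ) (k : ℕ) : ℝ :=
  if k.Prime then -Real.log (1 - g k) else 0

theorem summatory_sub_summatory (w : ℕ → ℝ) {u v : ℝ} (huv : u ≤ v) :
    summatory w v - summatory w u = ∑ k ∈ Finset.Ioc ⌊u⌋₊ ⌊v⌋₊, w k := by
  have h1 : Finset.Icc 0 ⌊v⌋₊ = Finset.Icc 0 ⌊u⌋₊ ∪ Finset.Ioc ⌊u⌋₊ ⌊v⌋₊ := by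
    have := Nat.floor_le_floor huv
    ext k
    simp only [Finset.mem_Icc, Finset.mem_union, Finset.mem_Ioc]
    omega
  have h2 : Disjoint (Finset.Icc 0 ⌊u⌋₊) (Finset.Ioc ⌊u⌋₊ ⌊v⌋₊) := by
    rw [Finset.disjoint_left]
    intro k hk hk'
    rw [Finset.mem_Icc] at hk
    rw [Finset.mem_Ioc] at hk'
    omega
  rw [summatory, summatory, h1, Finset.sum_union h2]
  ring

theorem half_le_log {u : ℝ} (hu : 2 ≤ u) : 1 / 2 ≤ Real.log u := by
  have := Real.log_le_log (by norm_num) hu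
  linarith [Real.log_two_gt_d9]

theorem hasDerivAt_inv_log {t : ℝ} (ht : 1 < t) :
    HasDerivAt (fun t => (Real.log t)⁻¹) (-(t⁻¹ / Real.log t ^ 2)) t := by
  refine ((Real.hasDerivAt_log (by linarith)).inv (Real.log_pos ht).ne').congr_deriv ?_
  ring

theorem hasDerivAt_inv_log_sq {t : ℝ} (ht : 1 < t) :
    HasDerivAt (fun t => ((Real.log t) ^ 2)⁻¹) (-(2 * t⁻¹ / Real.log t ^ 3)) t := by
  have h0 := (Real.log_pos ht).ne'
  have h1 : t ≠ 0 := by linarith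
  refine (((Real.hasDerivAt_log (by linarith)).pow 2).inv (pow_ne_zero 2 h0)).congr_deriv ?_
  simp only [Pi.pow_apply]
  field_simp
  norm_num [mul_comm]

namespace SieveDensity

variable {A₁ A₂ κ L D : ℝ} {g h : ℕ → ℝ}

theorem abs_summatory_primeWeight_sub_le (S : SieveDensity A₁ A₂ κ L g h) (hD1 : 6 * L ≤ D)
    (hD2 : A₂ + κ ≤ D) {t : ℝ} (ht : 1 ≤ t) :
    |summatory (primeWeight g) t - κ * Real.log t| ≤ D := by
  have := S.summatory_primeWeight_bounds ht
  rw [abs_le]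
  constructor <;> linarith

theorem abs_sum_primeWeight_div_log_sub_le (S : SieveDensity A₁ A₂ κ L g h) (hD1 : 6 * L ≤ D)
    (hD2 : A₂ + κ ≤ D) {u v : ℝ} (hu : 2 ≤ u) (huv : u ≤ v) :
    |∑ k ∈ Finset.Ioc ⌊u⌋₊ ⌊v⌋₊, (Real.log k)⁻¹ * primeWeight g k -
      κ * (Real.log (Real.log v) - Real.log (Real.log u))| ≤ 2 * D / Real.log u := by
  have h1 : ∀ t ∈ Set.Icc u v, 1 < t := fun t ht => by linarith [ht.1]
  have hlog : ContinuousOn Real.log (Set.Icc u v) :=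
    Real.continuousOn_log.mono fun t ht => by
      have := h1 t ht
      simp only [Set.mem_compl_iff, Set.mem_singleton_iff]
      linarith
  refine (abs_sum_mul_sub_le (primeWeight g) (fun t => (Real.log t)⁻¹)
    (fun t => -(t⁻¹ / Real.log t ^ 2)) (fun t => Real.log (Real.log t)) (by linarith) huv
    (fun t ht => S.abs_summatory_primeWeight_sub_le hD1 hD2 (by linarith))
    (fun t ht => hasDerivAt_inv_log (h1 t ht)) ?_ (fun t ht => ?_) ?_ fun t ht => ?_)
  · refine (ContinuousOn.div (continuousOn_id.inv₀ fun t ht => ?_) (hlog.pow 2) fun t ht => ?_).neg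
    · have := h1 t ht
      simp only [id]; linarith
    · exact pow_ne_zero 2 (Real.log_pos (h1 t ht)).ne'
  · have := h1 t ht
    rw [neg_nonpos]
    positivity
  · exact inv_nonneg.mpr (Real.log_nonneg (by linarith))
  · refine ((Real.hasDerivAt_log (by linarith [h1 t ht])).log
      (Real.log_pos (h1 t ht)).ne').congr_deriv ?_
    rw [div_eq_mul_inv, div_eq_mul_inv, mul_comm]

theorem sum_primeWeight_div_log_sq_le (S : SieveDensity A₁ A₂ κ L g h) (hD1 : 6 * L ≤ D)
    (hD2 : A₂ + κ ≤ D) {u v : ℝ} (hu : 2 ≤ u) (huv : u ≤ v) :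
    ∑ k ∈ Finset.Ioc ⌊u⌋₊ ⌊v⌋₊, ((Real.log k) ^ 2)⁻¹ * primeWeight g k ≤
      5 * D / Real.log u := by
  have h1 : ∀ t ∈ Set.Icc u v, 1 < t := fun t ht => by linarith [ht.1]
  have hlog : ContinuousOn Real.log (Set.Icc u v) :=
    Real.continuousOn_log.mono fun t ht => by
      have := h1 t ht
      simp only [Set.mem_compl_iff, Set.mem_singleton_iff]
      linarith
  have key := abs_sum_mul_sub_le (primeWeight g) (fun t => ((Real.log t) ^ 2)⁻¹)
    (fun t => -(2 * t⁻¹ / Real.log t ^ 3)) (fun t => -(Real.log t)⁻¹) (by linarith) huv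
    (fun t ht => S.abs_summatory_primeWeight_sub_le hD1 hD2 (by linarith))
    (fun t ht => hasDerivAt_inv_log_sq (h1 t ht)) ?_ (fun t ht => ?_) ?_ fun t ht => ?_
  · have key := (abs_le.mp key).2
    have hl := half_le_log hu
    have hv : 0 ≤ (Real.log v)⁻¹ := inv_nonneg.mpr (Real.log_nonneg (by linarith))
    have hi : (Real.log u)⁻¹ ≤ 2 := by
      rw [inv_le_comm₀ (by linarith) (by norm_num)]
      linarith
    have hi0 : 0 < (Real.log u)⁻¹ := inv_pos.mpr (by linarith)
    have hsq : ((Real.log u) ^ 2)⁻¹ ≤ 2 * (Real.log u)⁻¹ := by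
      rw [← inv_pow]; nlinarith
    have hκ := S.pos_κ
    have hA₂ := S.pos_A₂
    have hD : 0 < D := by linarith
    have e1 : 2 * D * ((Real.log u) ^ 2)⁻¹ ≤ 2 * D * (2 * (Real.log u)⁻¹) :=
      mul_le_mul_of_nonneg_left hsq (by linarith)
    have e2 : κ * (Real.log u)⁻¹ ≤ D * (Real.log u)⁻¹ :=
      mul_le_mul_of_nonneg_right (by linarith) hi0.le
    have e3 : 0 ≤ κ * (Real.log v)⁻¹ := mul_nonneg hκ.le hv
    rw [div_eq_mul_inv]
    linarith
  · refine (ContinuousOn.div (continuousOn_const.mul (continuousOn_id.inv₀ fun t ht => ?_))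
      (hlog.pow 3) fun t ht => ?_).neg
    · have := h1 t ht
      simp only [id]; linarith
    · exact pow_ne_zero 3 (Real.log_pos (h1 t ht)).ne'
  · have := h1 t ht
    have := Real.log_pos this
    rw [neg_nonpos]
    positivity
  · positivity
  · refine (hasDerivAt_inv_log (h1 t ht)).neg.congr_deriv ?_
    rw [neg_neg, div_eq_mul_inv, div_eq_mul_inv, mul_comm]

theorem inv_log_mul_primeWeight (g : ℕ → ℝ) {p : ℕ} (hp : p.Prime) :
    (Real.log p)⁻¹ * primeWeight g p = g p := by
  have : Real.log p ≠ 0 := (Real.log_pos (by exact_mod_cast hp.one_lt)).ne'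
  rw [primeWeight, if_pos hp]
  field_simp

/-- The gap between `h(p)` and `g(p)` is quadratically small. -/
theorem h_sub_g_le (S : SieveDensity A₁ A₂ κ L g h) {p : ℕ} (hp : p.Prime) :
    h p - g p ≤ A₁ * (A₂ + κ) * (((Real.log p) ^ 2)⁻¹ * primeWeight g p) := by
  have hl : 0 < Real.log p := Real.log_pos (by exact_mod_cast hp.one_lt)
  have hg := S.g_mem p hp
  have h1 : h p - g p = g p * h p := by
    have := (S.one_sub_pos hp).ne'
    rw [S.h_prime p hp]; field_simp; ring
  have h2 : g p ≤ (A₂ + κ) * (Real.log p)⁻¹ := by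
    rw [← div_eq_mul_inv, le_div_iff₀ hl]
    exact S.g_mul_log_le hp
  have h3 : ((Real.log p) ^ 2)⁻¹ * primeWeight g p = (Real.log p)⁻¹ * g p := by
    rw [primeWeight, if_pos hp]; field_simp
  have hA₁ : 0 < A₁ := zero_lt_one.trans_le S.one_le
  rw [h1, h3]
  calc g p * h p ≤ g p * (A₁ * g p) := mul_le_mul_of_nonneg_left (S.h_le hp) hg.1
    _ = A₁ * g p * g p := by ring
    _ ≤ A₁ * g p * ((A₂ + κ) * (Real.log p)⁻¹) :=
        mul_le_mul_of_nonneg_left h2 (mul_nonneg hA₁.le hg.1)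
    _ = _ := by ring

theorem logFactor_bounds (S : SieveDensity A₁ A₂ κ L g h) (k : ℕ) :
    (Real.log k)⁻¹ * primeWeight g k ≤ logFactor g k ∧
      logFactor g k ≤ (Real.log k)⁻¹ * primeWeight g k +
        A₁ * (A₂ + κ) * (((Real.log k) ^ 2)⁻¹ * primeWeight g k) := by
  by_cases hk : k.Prime
  · have h1 := S.g_le_neg_log hk
    have h2 := S.neg_log_le_h hk
    have h3 := S.h_sub_g_le hk
    rw [inv_log_mul_primeWeight g hk, logFactor, if_pos hk]
    constructor <;> linarith
  · simp [logFactor, primeWeight, hk]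

theorem logFactor_nonneg (S : SieveDensity A₁ A₂ κ L g h) (k : ℕ) : 0 ≤ logFactor g k :=
  le_trans (mul_nonneg (inv_nonneg.mpr (Real.log_natCast_nonneg k)) (S.primeWeight_nonneg k))
    (S.logFactor_bounds k).1

theorem abs_summatory_logFactor_sub_le (S : SieveDensity A₁ A₂ κ L g h) (hD1 : 6 * L ≤ D)
    (hD2 : A₂ + κ ≤ D) {u v : ℝ} (hu : 2 ≤ u) (huv : u ≤ v) :
    |(summatory (logFactor g) v - κ * Real.log (Real.log v)) -
      (summatory (logFactor g) u - κ * Real.log (Real.log u))| ≤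
      D * (2 + 5 * A₁ * (A₂ + κ)) / Real.log u := by
  have h1 := abs_le.mp (S.abs_sum_primeWeight_div_log_sub_le hD1 hD2 hu huv)
  have h2 := S.sum_primeWeight_div_log_sq_le hD1 hD2 hu huv
  have h3 := summatory_sub_summatory (logFactor g) huv
  have h4 := Finset.sum_le_sum fun k (_ : k ∈ Finset.Ioc ⌊u⌋₊ ⌊v⌋₊) => (S.logFactor_bounds k).1
  have h5 := Finset.sum_le_sum fun k (_ : k ∈ Finset.Ioc ⌊u⌋₊ ⌊v⌋₊) => (S.logFactor_bounds k).2
  rw [Finset.sum_add_distrib, ← Finset.mul_sum] at h5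
  have hA₁ : 0 < A₁ := zero_lt_one.trans_le S.one_le
  have hB : 0 < A₁ * (A₂ + κ) := mul_pos hA₁ (by linarith [S.pos_A₂, S.pos_κ])
  have h6 := mul_le_mul_of_nonneg_left h2 hB.le
  have h7 : D * (2 + 5 * A₁ * (A₂ + κ)) / Real.log u =
      2 * D / Real.log u + A₁ * (A₂ + κ) * (5 * D / Real.log u) := by ring
  have hD : 0 < D := by linarith [S.pos_A₂, S.pos_κ]
  have h8 : 0 ≤ A₁ * (A₂ + κ) * (5 * D / Real.log u) :=
    mul_nonneg hB.le (div_nonneg (by linarith) (Real.log_nonneg (by linarith)))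
  rw [h7, abs_le]
  constructor <;> linarith [h1.1, h1.2]

/-- Mertens' theorem for the density `g`. -/
theorem exists_abs_summatory_logFactor_sub_le (S : SieveDensity A₁ A₂ κ L g h)
    (hD1 : 6 * L ≤ D) (hD2 : A₂ + κ ≤ D) :
    ∃ b : ℝ, ∀ u : ℝ, 2 ≤ u →
      |summatory (logFactor g) u - κ * Real.log (Real.log u) - b| ≤
        D * (2 + 5 * A₁ * (A₂ + κ)) / Real.log u := by
  set F : ℝ → ℝ := fun t => summatory (logFactor g) t - κ * Real.log (Real.log t) with hF
  set B := D * (2 + 5 * A₁ * (A₂ + κ)) with hB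
  have hle : ∀ u v : ℝ, 2 ≤ u → u ≤ v → |F v - F u| ≤ B / Real.log u := fun u v hu huv =>
    S.abs_summatory_logFactor_sub_le hD1 hD2 hu huv
  have hlim : Filter.Tendsto (fun u => B / Real.log u) Filter.atTop (nhds 0) :=
    Real.tendsto_log_atTop.const_div_atTop B
  have hcauchy : Cauchy (Filter.map F Filter.atTop) := by
    rw [Metric.cauchy_iff]
    refine ⟨inferInstance, fun ε hε => ?_⟩
    obtain ⟨u, hu1, hu2⟩ := ((hlim.eventually (gt_mem_nhds (half_pos hε))).and
      (Filter.eventually_ge_atTop 2)).exists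
    refine ⟨F '' Set.Ici u, Filter.image_mem_map (Filter.Ici_mem_atTop u), ?_⟩
    rintro _ ⟨v, hv, rfl⟩ _ ⟨w, hw, rfl⟩
    have h1 := hle u v hu2 hv
    have h2 := hle u w hu2 hw
    have h3 : dist (F v) (F w) ≤ |F v - F u| + |F w - F u| := by
      rw [← Real.dist_eq, ← Real.dist_eq]
      exact dist_triangle_right _ _ _
    linarith
  obtain ⟨b, hb⟩ := cauchy_map_iff_exists_tendsto.mp hcauchy
  refine ⟨b, fun u hu => ?_⟩
  have h1 : Filter.Tendsto (fun v => |F v - F u|) Filter.atTop (nhds |b - F u|) :=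
    (hb.sub_const _).abs
  have h2 := le_of_tendsto h1 (Filter.eventually_atTop.mpr ⟨u, fun v hv => hle u v hu hv⟩)
  rwa [abs_sub_comm] at h2

theorem summable_primeWeight_div_log_sq (S : SieveDensity A₁ A₂ κ L g h) :
    Summable fun k : ℕ => ((Real.log k) ^ 2)⁻¹ * primeWeight g k := by
  set D := max (6 * L) (A₂ + κ)
  have hnn : ∀ k : ℕ, 0 ≤ ((Real.log k) ^ 2)⁻¹ * primeWeight g k := fun k =>
    mul_nonneg (by positivity) (S.primeWeight_nonneg k)
  refine (summable_nat_add_iff 3).mp ?_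
  refine summable_of_sum_range_le (c := 5 * D / Real.log 2) (fun k => hnn _) fun n => ?_
  refine le_trans ?_ (S.sum_primeWeight_div_log_sq_le (le_max_left _ _) (le_max_right _ _)
    le_rfl (v := 2 + n) (by linarith [n.cast_nonneg (α := ℝ)]))
  have h2 : ⌊(2 : ℝ)⌋₊ = 2 := by exact_mod_cast Nat.floor_natCast (R := ℝ) 2
  have h3 : ⌊(2 + n : ℝ)⌋₊ = 2 + n := by exact_mod_cast Nat.floor_natCast (R := ℝ) (2 + n)
  rw [h2, h3]
  apply le_of_eq
  refine Finset.sum_nbij (fun i => i + 3) ?_ ?_ ?_ ?_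
  · intro i hi
    rw [Finset.mem_range] at hi
    rw [Finset.mem_Ioc]
    omega
  · intro i _ j _ hij
    simpa using hij
  · intro k hk
    rw [Finset.mem_coe, Finset.mem_Ioc] at hk
    exact ⟨k - 3, by rw [Finset.mem_coe, Finset.mem_range]; omega, by simp only []; omega⟩
  · intro i _
    rfl

/-- Comparison of `W` with the summatory function of `-log (1 - g(p))`. -/
theorem log_prod_bounds (S : SieveDensity A₁ A₂ κ L g h) {z : ℝ} (hz : 2 ≤ z) :
    0 ≤ summatory (logFactor g) z +
        Real.log (∏ p ∈ (Finset.range ⌈z⌉₊).filter Nat.Prime, (1 - g p)) ∧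
      summatory (logFactor g) z +
        Real.log (∏ p ∈ (Finset.range ⌈z⌉₊).filter Nat.Prime, (1 - g p)) ≤
        A₁ * (A₂ + κ) / Real.log z := by
  have hlz : 0 < Real.log z := Real.log_pos (by linarith)
  have hA₁ : 0 < A₁ := zero_lt_one.trans_le S.one_le
  have hnn : 0 ≤ A₁ * (A₂ + κ) / Real.log z :=
    div_nonneg (mul_nonneg hA₁.le (by linarith [S.pos_A₂, S.pos_κ])) hlz.le
  have h1 : Real.log (∏ p ∈ (Finset.range ⌈z⌉₊).filter Nat.Prime, (1 - g p)) =
      -∑ k ∈ Finset.range ⌈z⌉₊, logFactor g k := by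
    rw [Real.log_prod fun p hp => (S.one_sub_pos (Finset.mem_filter.mp hp).2).ne',
      Finset.sum_filter, ← Finset.sum_neg_distrib]
    refine Finset.sum_congr rfl fun k _ => ?_
    rw [logFactor]
    split_ifs <;> simp
  have h2 : summatory (logFactor g) z = ∑ k ∈ Finset.range (⌊z⌋₊ + 1), logFactor g k := by
    rw [summatory]
    refine Finset.sum_congr ?_ fun _ _ => rfl
    ext k
    simp only [Finset.mem_Icc, Finset.mem_range]
    omega
  rw [h1, h2]
  by_cases hc : ⌈z⌉₊ = ⌊z⌋₊ + 1
  · rw [hc, add_neg_cancel]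
    exact ⟨le_rfl, hnn⟩
  · have hc : ⌈z⌉₊ = ⌊z⌋₊ := by
      have := Nat.ceil_le_floor_add_one z
      have := Nat.floor_le_ceil z
      omega
    have hzn : (⌊z⌋₊ : ℝ) = z := le_antisymm (Nat.floor_le (by linarith)) (hc ▸ Nat.le_ceil z)
    rw [hc, Finset.sum_range_succ, add_neg_cancel_comm]
    refine ⟨S.logFactor_nonneg _, ?_⟩
    by_cases hp : (⌊z⌋₊).Prime
    · rw [logFactor, if_pos hp, le_div_iff₀ hlz]
      have h3 := S.g_mul_log_le hp
      have h4 := (S.neg_log_le_h hp).trans (S.h_le hp)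
      rw [hzn] at h3
      calc _ ≤ A₁ * g ⌊z⌋₊ * Real.log z := mul_le_mul_of_nonneg_right h4 hlz.le
        _ = A₁ * (g ⌊z⌋₊ * Real.log z) := by ring
        _ ≤ _ := mul_le_mul_of_nonneg_left h3 hA₁.le
    · rw [logFactor, if_neg hp]
      exact hnn

end SieveDensity

theorem hasSum_log_of_hasProd {f : ℕ → ℝ} {a : ℝ} (hf : ∀ n, 0 < f n) (ha : 0 < a)
    (h : HasProd f a) : HasSum (fun n => Real.log (f n)) (Real.log a) := by
  refine ((Real.continuousAt_log ha.ne').tendsto.comp h).congr fun s => ?_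
  exact Real.log_prod fun n _ => (hf n).ne'

theorem monotone_summatory {w : ℕ → ℝ} (hw : ∀ n, 0 ≤ w n) : Monotone (summatory w) :=
  fun _ _ hxy => Finset.sum_le_sum_of_subset_of_nonneg
    (Finset.Icc_subset_Icc le_rfl (Nat.floor_le_floor hxy)) fun n _ _ => hw n

namespace SieveDensity

open Filter Topology MeasureTheory

variable {A₁ A₂ κ L : ℝ} {g h : ℕ → ℝ}

/-- The logarithm of the `p`-th Euler factor of `∑ μ(n)² h(n) n ^ (-s)`. -/
noncomputable def eulerLog (h : ℕ → ℝ) (s : ℝ) (k : ℕ) : ℝ :=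
  if k.Prime then Real.log (1 + h k * (k : ℝ) ^ (-s)) else 0

theorem tsum_sqfreeWeight_prime_pow (h : ℕ → ℝ) (S : SieveDensity A₁ A₂ κ L g h) (s : ℝ) {p : ℕ}
    (hp : p.Prime) :
    ∑' e : ℕ, sqfreeWeight h (p ^ e) * ((p ^ e : ℕ) : ℝ) ^ (-s) = 1 + h p * (p : ℝ) ^ (-s) := by
  rw [tsum_eq_sum (s := Finset.range 2)]
  · rw [Finset.sum_range_succ, Finset.sum_range_one, pow_zero, pow_one, S.sqfreeWeight_one,
      sqfreeWeight_of_squarefree h hp.prime.squarefree]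
    simp
  · intro e he
    rw [Finset.mem_range, not_lt] at he
    rw [sqfreeWeight_of_not_squarefree, zero_mul]
    intro hsq
    have := (Nat.squarefree_pow_iff hp.ne_one (by omega)).mp hsq
    omega

theorem hasSum_eulerLog (S : SieveDensity A₁ A₂ κ L g h) {s I : ℝ} (hI0 : 0 < I)
    (hI : HasSum (fun n : ℕ => sqfreeWeight h n * (n : ℝ) ^ (-s)) I) :
    HasSum (eulerLog h s) (Real.log I) := by
  have hnn : ∀ n : ℕ, 0 ≤ sqfreeWeight h n * (n : ℝ) ^ (-s) := fun n =>
    mul_nonneg (S.sqfreeWeight_nonneg n) (by positivity)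
  have hprod := EulerProduct.eulerProduct_hasProd_mulIndicator
    (f := fun n : ℕ => sqfreeWeight h n * (n : ℝ) ^ (-s)) (by simp [S.sqfreeWeight_one])
    (fun {m n} hmn => by
      rw [S.sqfreeWeight_mul hmn, Nat.cast_mul,
        Real.mul_rpow (Nat.cast_nonneg m) (Nat.cast_nonneg n)]
      ring)
    (by simpa only [Real.norm_of_nonneg (hnn _)] using hI.summable)
    (by simp [sqfreeWeight_zero])
  rw [hI.tsum_eq] at hprod
  have hpos : ∀ n : ℕ, n.Prime → 0 < 1 + h n * (n : ℝ) ^ (-s) := fun n hn => by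
    have := S.h_nonneg_prime hn
    positivity
  refine (hasSum_log_of_hasProd (fun n => ?_) hI0 hprod).congr_fun ?_
  · by_cases hn : n.Prime
    · rw [Set.mulIndicator_of_mem (show n ∈ {p | Nat.Prime p} from hn)]
      rw [tsum_sqfreeWeight_prime_pow h S s hn]
      exact hpos n hn
    · rw [Set.mulIndicator_of_notMem (show n ∉ {p | Nat.Prime p} from hn)]
      exact zero_lt_one
  · intro n
    by_cases hn : n.Prime
    · rw [Set.mulIndicator_of_mem (show n ∈ {p | Nat.Prime p} from hn)]
      rw [tsum_sqfreeWeight_prime_pow h S s hn, eulerLog, if_pos hn]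
    · rw [Set.mulIndicator_of_notMem (show n ∉ {p | Nat.Prime p} from hn), eulerLog, if_neg hn,
        Real.log_one]

theorem abs_eulerLog_sub_le (S : SieveDensity A₁ A₂ κ L g h) {s : ℝ} (hs : 0 < s) (k : ℕ) :
    |eulerLog h s k - logFactor g k * (k : ℝ) ^ (-s)| ≤
      A₁ * (A₂ + κ) * (((Real.log k) ^ 2)⁻¹ * primeWeight g k) := by
  by_cases hk : k.Prime
  · rw [eulerLog, if_pos hk, logFactor, if_pos hk]
    refine le_trans ?_ (S.h_sub_g_le hk)
    set q := (k : ℝ) ^ (-s) with hq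
    have hq0 : 0 ≤ q := by positivity
    have hq1 : q ≤ 1 :=
      Real.rpow_le_one_of_one_le_of_nonpos (by exact_mod_cast hk.one_lt.le) (by linarith)
    have h1 := S.g_le_neg_log hk
    have h2 := S.neg_log_le_h hk
    have hh := S.h_nonneg_prime hk
    have hx : 0 < 1 + h k * q := by positivity
    have h3 := Real.log_le_sub_one_of_pos hx
    have h4 := Real.one_sub_inv_le_log_of_pos hx
    have h5 : q * g k ≤ 1 - (1 + h k * q)⁻¹ := by
      have e1 : g k = h k / (1 + h k) := by
        have := (S.one_sub_pos hk).ne'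
        rw [S.one_add_h hk, S.h_prime k hk]
        field_simp
      have e2 : 1 - (1 + h k * q)⁻¹ = h k * q / (1 + h k * q) := by
        field_simp
        ring
      rw [e1, e2, ← mul_div_assoc, mul_comm q]
      apply div_le_div_of_nonneg_left (by positivity) hx
      nlinarith
    have h6 := mul_le_mul_of_nonneg_left h1 hq0
    have h7 := mul_le_mul_of_nonneg_left h2 hq0
    have h8 : q * (h k - g k) ≤ h k - g k := mul_le_of_le_one_left (by linarith) hq1
    rw [abs_le]
    constructor <;> nlinarith
  · simp [eulerLog, logFactor, primeWeight, hk]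

theorem tendsto_eulerLog_sub (S : SieveDensity A₁ A₂ κ L g h) (k : ℕ) :
    Tendsto (fun s : ℝ => eulerLog h s k - logFactor g k * (k : ℝ) ^ (-s)) (𝓝[>] 0) (𝓝 0) := by
  by_cases hk : k.Prime
  · have h1 : Tendsto (fun s : ℝ => (k : ℝ) ^ (-s)) (𝓝[>] 0) (𝓝 1) := by
      have : ContinuousAt (fun s : ℝ => (k : ℝ) ^ (-s)) 0 :=
        (Real.continuousAt_const_rpow (by exact_mod_cast hk.ne_zero)).comp continuousAt_neg
      have := this.tendsto
      simp only [neg_zero, Real.rpow_zero] at this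
      exact this.mono_left nhdsWithin_le_nhds
    have hh := S.h_nonneg_prime hk
    have h2 := ((h1.const_mul (h k)).const_add 1).log (by rw [mul_one]; linarith)
    have h3 := h2.sub (h1.const_mul (logFactor g k))
    have h4 : Real.log (1 + h k * 1) - logFactor g k * 1 = 0 := by
      rw [mul_one, mul_one, S.one_add_h hk, logFactor, if_pos hk, Real.log_inv, sub_self]
    rw [h4] at h3
    simpa only [eulerLog, if_pos hk] using h3
  · simp [eulerLog, logFactor, hk]

theorem logFactor_zero (g : ℕ → ℝ) : logFactor g 0 = 0 := by
  simp [logFactor, Nat.not_prime_zero]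

set_option maxHeartbeats 1000000 in
/-- Identification of the constant in the asymptotic formula of the summatory function of `μ² h`
by comparing the behaviour of the Dirichlet series with its Euler product at `0`. -/
theorem mul_Gamma_eq_exp (S : SieveDensity A₁ A₂ κ L g h) {c b K K' : ℝ} (hc : 0 < c)
    (hK : ∀ y, 0 ≤ y → |summatory (sqfreeWeight h) (Real.exp y)| ≤ K * (1 + y) ^ κ)
    (hlim : Tendsto (fun y => summatory (sqfreeWeight h) (Real.exp y) / y ^ κ) atTop (𝓝 c))
    (hK0 : ∀ y, 0 ≤ y → y ≤ 1 → |summatory (logFactor g) (Real.exp y)| ≤ K')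
    (hK1 : ∀ y, 1 ≤ y → |summatory (logFactor g) (Real.exp y) - κ * Real.log y| ≤ K')
    (hlim' : Tendsto (fun y => summatory (logFactor g) (Real.exp y) - κ * Real.log y)
      atTop (𝓝 b)) :
    c * Real.Gamma (κ + 1) = Real.exp (b - κ * Real.eulerMascheroniConstant) := by
  have hκ := S.pos_κ
  have hm1 : Measurable fun y => summatory (sqfreeWeight h) (Real.exp y) :=
    (measurable_summatory _).comp Real.measurable_exp
  have hm2 : Measurable fun y => summatory (logFactor g) (Real.exp y) :=
    (measurable_summatory _).comp Real.measurable_exp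
  set I : ℝ → ℝ := fun s =>
    ∫ x in Set.Ioi 0, summatory (sqfreeWeight h) (Real.exp (x / s)) * Real.exp (-x) with hI
  set J : ℝ → ℝ := fun s =>
    ∫ x in Set.Ioi 0, summatory (logFactor g) (Real.exp (x / s)) * Real.exp (-x) with hJ
  have hIlim : Tendsto (fun s => s ^ κ * I s) (𝓝[>] 0) (𝓝 (c * Real.Gamma (κ + 1))) :=
    tendsto_rpow_mul_integral_comp_div hκ hm1 hK hlim
  have hJlim : Tendsto (fun s => J s + κ * Real.log s) (𝓝[>] 0)
      (𝓝 (b - κ * Real.eulerMascheroniConstant)) :=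
    tendsto_integral_comp_div_add_log hκ hm2 hK0 hK1 hlim'
  have hpos : 0 < c * Real.Gamma (κ + 1) := mul_pos hc (Real.Gamma_pos_of_pos (by linarith))
  have hev : ∀ᶠ s : ℝ in 𝓝[>] 0, 0 < s ∧ s ≤ 1 := by
    filter_upwards [Ioc_mem_nhdsGT (zero_lt_one : (0 : ℝ) < 1)] with s hs using hs
  have hIsum : ∀ s : ℝ, 0 < s → s ≤ 1 →
      HasSum (fun n : ℕ => sqfreeWeight h n * (n : ℝ) ^ (-s)) (I s) := fun s hs hs1 =>
    hasSum_mul_rpow_neg _ S.sqfreeWeight_nonneg (sqfreeWeight_zero h) hs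
      (integrableOn_comp_div_mul_exp_neg hκ hm1 hK hs hs1)
  have hJsum : ∀ s : ℝ, 0 < s → s ≤ 1 →
      HasSum (fun n : ℕ => logFactor g n * (n : ℝ) ^ (-s)) (J s) := fun s hs hs1 =>
    hasSum_mul_rpow_neg _ S.logFactor_nonneg (logFactor_zero g) hs
      (integrableOn_comp_div_mul_exp_neg zero_lt_one hm2
        (fun y hy => abs_le_mul_one_add_of_abs_sub_log_le hκ hK0 hK1 hy) hs hs1)
  have hIpos : ∀ s : ℝ, 0 < s → s ≤ 1 → 0 < I s := fun s hs hs1 => by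
    have h1 := le_hasSum (hIsum s hs hs1) 1 fun n _ =>
      mul_nonneg (S.sqfreeWeight_nonneg n) (by positivity)
    rw [S.sqfreeWeight_one, Nat.cast_one, Real.one_rpow, mul_one] at h1
    linarith
  have hdiff : Tendsto (fun s => Real.log (I s) - J s) (𝓝[>] 0) (𝓝 0) := by
    have h1 := tendsto_tsum_of_dominated_convergence
      (S.summable_primeWeight_div_log_sq.mul_left (A₁ * (A₂ + κ))) S.tendsto_eulerLog_sub
      (hev.mono fun s hs k => by
        rw [Real.norm_eq_abs]
        exact S.abs_eulerLog_sub_le hs.1 k)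
    rw [tsum_zero] at h1
    refine h1.congr' (hev.mono fun s hs => ?_)
    exact ((S.hasSum_eulerLog (hIpos s hs.1 hs.2) (hIsum s hs.1 hs.2)).sub
      (hJsum s hs.1 hs.2)).tsum_eq
  have hlog : Tendsto (fun s => Real.log (I s) + κ * Real.log s) (𝓝[>] 0)
      (𝓝 (Real.log (c * Real.Gamma (κ + 1)))) := by
    refine (hIlim.log hpos.ne').congr' (hev.mono fun s hs => ?_)
    rw [Real.log_mul (Real.rpow_pos_of_pos hs.1 κ).ne' (hIpos s hs.1 hs.2).ne',
      Real.log_rpow hs.1, add_comm]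
  have hlog' := hdiff.add hJlim
  rw [zero_add] at hlog'
  have heq := tendsto_nhds_unique hlog (hlog'.congr fun s => by ring)
  rw [← heq, Real.exp_log hpos]

end SieveDensity

theorem abs_exp_sub_one_le_mul_exp (x : ℝ) : |Real.exp x - 1| ≤ |x| * Real.exp |x| := by
  rcases le_total 0 x with hx | hx
  · rw [abs_of_nonneg hx, abs_of_nonneg (by linarith [Real.add_one_le_exp x])]
    have h1 := Real.add_one_le_exp (-x)
    have h2 : Real.exp (-x) * Real.exp x = 1 := by rw [← Real.exp_add]; simp
    nlinarith [Real.exp_pos x]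
  · rw [abs_of_nonpos hx, abs_of_nonpos (by linarith [Real.exp_le_one_iff.mpr hx])]
    have h1 := Real.add_one_le_exp x
    have h2 := Real.one_le_exp (neg_nonneg.mpr hx)
    nlinarith

theorem abs_log_le_two_mul {r : ℝ} (hr : 0 ≤ r) (hr' : r ≤ 1 / 2) :
    Real.log (1 + r) ≤ r ∧ -(2 * r) ≤ Real.log (1 - r) := by
  refine ⟨by linarith [Real.log_le_sub_one_of_pos (by linarith : 0 < 1 + r)], ?_⟩
  refine le_trans ?_ (Real.one_sub_inv_le_log_of_pos (by linarith : 0 < 1 - r))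
  have h1 : (1 - r)⁻¹ ≤ 1 + 2 * r := by
    rw [inv_le_iff_one_le_mul₀ (by linarith)]
    nlinarith
  linarith

/-- Logarithmic form of a two-sided bound around `c y ^ κ`. -/
theorem abs_log_sub_le_of_bounds {c y D κ G : ℝ} (hc : 0 < c) (hκ : 0 < κ) (hD : 0 < D)
    (hy : 2 * D ≤ y) (hG : 0 < G) (h1 : c * (y - D) ^ (κ + 1) ≤ (y + D) * G)
    (h2 : (y - D) * G ≤ c * (y + D) ^ (κ + 1)) :
    |Real.log G - Real.log c - κ * Real.log y| ≤ (2 * κ + 3) * (D / y) := by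
  have hy0 : 0 < y := by linarith
  set r := D / y with hr
  have hr0 : 0 ≤ r := by positivity
  have hr1 : r ≤ 1 / 2 := by rw [hr, div_le_iff₀ hy0]; linarith
  have e1 : y - D = y * (1 - r) := by rw [hr]; field_simp
  have e2 : y + D = y * (1 + r) := by rw [hr]; field_simp
  have hp : 0 < 1 + r := by linarith
  have hm : 0 < 1 - r := by linarith
  have hrp : ∀ t : ℝ, 0 < t → 0 < t ^ (κ + 1) := fun t ht => Real.rpow_pos_of_pos ht _
  rw [e1, e2] at h1 h2
  have hyp := mul_pos hy0 hp
  have hym := mul_pos hy0 hm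
  have g1 := Real.log_le_log (mul_pos hc (hrp _ hym)) h1
  have g2 := Real.log_le_log (mul_pos hym hG) h2
  rw [Real.log_mul hc.ne' (hrp _ hym).ne', Real.log_rpow hym, Real.log_mul hyp.ne' hG.ne',
    Real.log_mul hy0.ne' hp.ne', Real.log_mul hy0.ne' hm.ne'] at g1
  rw [Real.log_mul hc.ne' (hrp _ hyp).ne', Real.log_rpow hyp, Real.log_mul hym.ne' hG.ne',
    Real.log_mul hy0.ne' hp.ne', Real.log_mul hy0.ne' hm.ne'] at g2
  obtain ⟨b1, b2⟩ := abs_log_le_two_mul hr0 hr1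
  have b3 := mul_le_mul_of_nonneg_left b1 (by linarith : 0 ≤ κ + 1)
  have b4 := mul_le_mul_of_nonneg_left b2 (by linarith : 0 ≤ κ + 1)
  have b5 : 0 ≤ κ * r := by positivity
  rw [abs_le]
  constructor <;> linarith

section Asymptotics

open Filter Topology

theorem tendsto_div_rpow_of_bounds {c D κ : ℝ} {M : ℝ → ℝ} (hc : 0 < c) (hκ : 0 < κ)
    (hD : 0 < D) (hM : ∀ y, 0 ≤ y → 0 < M y)
    (h : ∀ y, D < y → c * (y - D) ^ (κ + 1) ≤ (y + D) * M y ∧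
      (y - D) * M y ≤ c * (y + D) ^ (κ + 1)) :
    Tendsto (fun y => M y / y ^ κ) atTop (𝓝 c) := by
  have hlim : Tendsto (fun y => (2 * κ + 3) * (D / y)) atTop (𝓝 0) := by
    simpa using (tendsto_id.const_div_atTop D).const_mul (2 * κ + 3)
  have h1 : Tendsto (fun y => Real.log (M y) - Real.log c - κ * Real.log y) atTop (𝓝 0) := by
    refine squeeze_zero_norm' ?_ hlim
    filter_upwards [eventually_ge_atTop (2 * D)] with y hy
    exact abs_log_sub_le_of_bounds hc hκ hD hy (hM y (by linarith))
      (h y (by linarith)).1 (h y (by linarith)).2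
  have h2 := ((Real.continuous_exp.tendsto _).comp h1).const_mul c
  rw [Real.exp_zero, mul_one] at h2
  refine h2.congr' ?_
  filter_upwards [eventually_gt_atTop 0] with y hy
  rw [Function.comp_apply, Real.exp_sub, Real.exp_sub, Real.exp_log (hM y hy.le), Real.exp_log hc,
    mul_comm κ, Real.rpow_def_of_pos hy]
  field_simp

theorem exists_abs_le_mul_rpow {c κ : ℝ} (hκ : 0 < κ) {M : ℝ → ℝ} (hM : ∀ y, 0 ≤ M y)
    (hmono : Monotone M) (hlim : Tendsto (fun y => M y / y ^ κ) atTop (𝓝 c)) :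
    ∃ K, ∀ y, 0 ≤ y → |M y| ≤ K * (1 + y) ^ κ := by
  obtain ⟨Y, hY⟩ := eventually_atTop.mp
    ((hlim.eventually (gt_mem_nhds (lt_add_one c))).and (eventually_gt_atTop 0))
  have hc1 : 0 ≤ c + 1 := by
    have := (hY Y le_rfl).1
    have h0 : 0 ≤ M Y / Y ^ κ := div_nonneg (hM Y) (Real.rpow_nonneg (hY Y le_rfl).2.le _)
    linarith
  refine ⟨(c + 1) + M Y, fun y hy => ?_⟩
  rw [abs_of_nonneg (hM y)]
  have h1 : 1 ≤ (1 + y) ^ κ := Real.one_le_rpow (by linarith) hκ.le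
  rcases le_total Y y with hYy | hYy
  · obtain ⟨h2, h3⟩ := hY y hYy
    rw [div_lt_iff₀ (Real.rpow_pos_of_pos h3 _)] at h2
    have h4 : y ^ κ ≤ (1 + y) ^ κ := Real.rpow_le_rpow hy (by linarith) hκ.le
    nlinarith [mul_le_mul_of_nonneg_left h4 hc1, hM Y]
  · have h2 := hmono hYy
    nlinarith [hM Y]

namespace SieveDensity

variable {A₁ A₂ κ L D : ℝ} {g h : ℕ → ℝ}

theorem exists_summatory_asymptotics (S : SieveDensity A₁ A₂ κ L g h) (hD1 : 6 * L ≤ D)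
    (hD2 : A₂ + κ + 2 * A₁ * (A₂ + κ) * (κ + 2 * (A₂ + κ)) ≤ D) :
    ∃ c b : ℝ, 0 < c ∧
      (∀ y, 2 * D ≤ y → |Real.log (summatory (sqfreeWeight h) (Real.exp y)) - Real.log c -
        κ * Real.log y| ≤ (2 * κ + 3) * (D / y)) ∧
      (∀ u : ℝ, 2 ≤ u → |summatory (logFactor g) u - κ * Real.log (Real.log u) - b| ≤
        D * (2 + 5 * A₁ * (A₂ + κ)) / Real.log u) ∧
      c * Real.Gamma (κ + 1) = Real.exp (b - κ * Real.eulerMascheroniConstant) := by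
  have hκ := S.pos_κ
  have hA₂ := S.pos_A₂
  have hA₁ := S.one_le
  have hD3 : A₂ + κ ≤ D := by
    have : 0 ≤ 2 * A₁ * (A₂ + κ) * (κ + 2 * (A₂ + κ)) := by positivity
    linarith
  have hD : 0 < D := by linarith
  obtain ⟨c, hc, hcb⟩ := S.exists_summatory_sqfreeWeight_bounds hD1 hD2
  obtain ⟨b, hb⟩ := S.exists_abs_summatory_logFactor_sub_le hD1 hD3
  have hM : ∀ y, 0 ≤ y → 0 < summatory (sqfreeWeight h) (Real.exp y) := fun y hy =>
    zero_lt_one.trans_le (S.one_le_summatory (Real.one_le_exp hy))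
  refine ⟨c, b, hc, fun y hy => abs_log_sub_le_of_bounds hc hκ hD hy (hM y (by linarith))
    (hcb y (by linarith)).1 (hcb y (by linarith)).2, hb, ?_⟩
  have hlim := tendsto_div_rpow_of_bounds hc hκ hD hM hcb
  obtain ⟨K, hK⟩ := exists_abs_le_mul_rpow hκ
    (M := fun y => summatory (sqfreeWeight h) (Real.exp y))
    (fun y => Finset.sum_nonneg fun n _ => S.sqfreeWeight_nonneg n)
    ((monotone_summatory S.sqfreeWeight_nonneg).comp Real.exp_monotone) hlim
  set B := D * (2 + 5 * A₁ * (A₂ + κ)) with hB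
  have hB0 : 0 ≤ B := by positivity
  have hb1 : ∀ y, 1 ≤ y →
      |summatory (logFactor g) (Real.exp y) - κ * Real.log y - b| ≤ B / y := fun y hy => by
    have h2 : 2 ≤ Real.exp y := by linarith [Real.add_one_le_exp y]
    simpa only [Real.log_exp] using hb _ h2
  have hnn : ∀ x, 0 ≤ summatory (logFactor g) x := fun x =>
    Finset.sum_nonneg fun n _ => S.logFactor_nonneg n
  refine S.mul_Gamma_eq_exp (K' := |b| + B + summatory (logFactor g) (Real.exp 1)) hc hK hlim
    (fun y _ hy1 => ?_) (fun y hy => ?_) ?_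
  · rw [abs_of_nonneg (hnn _)]
    have := monotone_summatory S.logFactor_nonneg (Real.exp_le_exp.mpr hy1)
    linarith [abs_nonneg b]
  · have h1 := hb1 y hy
    have h2 : B / y ≤ B := div_le_self hB0 hy
    have h3 := abs_add_le (summatory (logFactor g) (Real.exp y) - κ * Real.log y - b) b
    rw [sub_add_cancel] at h3
    linarith [hnn (Real.exp 1)]
  · rw [← tendsto_sub_nhds_zero_iff]
    refine squeeze_zero_norm' ?_ (tendsto_id.const_div_atTop B)
    filter_upwards [eventually_ge_atTop 1] with y hy using hb1 y hy

theorem abs_log_inv_le (S : SieveDensity A₁ A₂ κ L g h) (hD1 : 6 * L ≤ D)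
    (hD2 : A₂ + κ + 2 * A₁ * (A₂ + κ) * (κ + 2 * (A₂ + κ)) ≤ D) {z : ℝ} (hz : 2 ≤ z)
    (hzD : 2 * D ≤ Real.log z) :
    |Real.log (1 / (summatory (sqfreeWeight h) z *
      (∏ p ∈ (Finset.range ⌈z⌉₊).filter Nat.Prime, (1 - g p)) *
      (Real.exp (Real.eulerMascheroniConstant * κ) * Real.Gamma (κ + 1))))| ≤
      (2 * κ + 3 + (2 + 5 * A₁ * (A₂ + κ)) + A₁) * (D / Real.log z) := by
  have hκ := S.pos_κ
  have hA₂ := S.pos_A₂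
  have hA₁ := S.one_le
  have hD3 : A₂ + κ ≤ D := by
    have : 0 ≤ 2 * A₁ * (A₂ + κ) * (κ + 2 * (A₂ + κ)) := by positivity
    linarith
  obtain ⟨c, b, hc, hG, hF, hcb⟩ := S.exists_summatory_asymptotics hD1 hD2
  have hlz : 0 < Real.log z := Real.log_pos (by linarith)
  have hG := hG _ hzD
  have hF := hF z hz
  rw [Real.exp_log (by linarith)] at hG
  obtain ⟨w1, w2⟩ := S.log_prod_bounds hz
  have hGpos : 0 < summatory (sqfreeWeight h) z :=
    zero_lt_one.trans_le (S.one_le_summatory (by linarith))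
  have hW := S.prod_pos ⌈z⌉₊
  set G := summatory (sqfreeWeight h) z
  set W := ∏ p ∈ (Finset.range ⌈z⌉₊).filter Nat.Prime, (1 - g p)
  have hΓ : 0 < Real.Gamma (κ + 1) := Real.Gamma_pos_of_pos (by linarith)
  have hlog := congrArg Real.log hcb
  rw [Real.log_exp, Real.log_mul hc.ne' hΓ.ne'] at hlog
  rw [one_div, Real.log_inv, Real.log_mul (mul_pos hGpos hW).ne'
    (mul_pos (Real.exp_pos _) hΓ).ne', Real.log_mul hGpos.ne' hW.ne',
    Real.log_mul (Real.exp_pos _).ne' hΓ.ne', Real.log_exp]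
  have h1 : A₁ * (A₂ + κ) / Real.log z ≤ A₁ * (D / Real.log z) := by
    rw [mul_div_assoc]
    gcongr
  have h2 : D * (2 + 5 * A₁ * (A₂ + κ)) / Real.log z =
    (2 + 5 * A₁ * (A₂ + κ)) * (D / Real.log z) := by ring
  rw [h2] at hF
  rw [abs_le] at hG hF ⊢
  have h3 : 0 ≤ A₁ * (D / Real.log z) := by
    have : 0 < D := by linarith
    positivity
  constructor <;> linarith [hG.1, hG.2, hF.1, hF.2]

theorem abs_inv_sub_one_le (S : SieveDensity A₁ A₂ κ L g h) (hD1 : 6 * L ≤ D)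
    (hD2 : A₂ + κ + 2 * A₁ * (A₂ + κ) * (κ + 2 * (A₂ + κ)) ≤ D) {m C₂ E z : ℝ} (hz : 2 ≤ z)
    (hm : m = 2 * κ + 3 + (2 + 5 * A₁ * (A₂ + κ)) + A₁)
    (hC₂ : C₂ = 2 * Real.exp (A₁ * (κ * (4 * (κ + 1)) + A₂)) +
      Real.exp (A₁ * ((κ * (4 * A₂ + 4 * (κ + 1)) + A₂) / Real.log 2)))
    (hE : E = Real.exp (Real.eulerMascheroniConstant * κ) * Real.Gamma (κ + 1)) :
    |1 / (summatory (sqfreeWeight h) z *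
      (∏ p ∈ (Finset.range ⌈z⌉₊).filter Nat.Prime, (1 - g p)) * E) - 1| ≤
      (m * Real.exp (m / 2) + 2 * (C₂ / E + 1)) * (D / Real.log z) := by
  have hκ := S.pos_κ
  have hA₂ := S.pos_A₂
  have hA₁ := S.one_le
  have hD : 0 < D := by linarith [S.pos_L]
  have hm0 : 0 ≤ m := by rw [hm]; positivity
  have hC0 : 0 ≤ C₂ := by rw [hC₂]; positivity
  have hE0 : 0 < E := by
    rw [hE]
    exact mul_pos (Real.exp_pos _) (Real.Gamma_pos_of_pos (by linarith))
  have hlz : 0 < Real.log z := Real.log_pos (by linarith)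
  have hr0 : 0 ≤ D / Real.log z := by positivity
  have hGpos : 0 < summatory (sqfreeWeight h) z :=
    zero_lt_one.trans_le (S.one_le_summatory (by linarith))
  have hW := S.prod_pos ⌈z⌉₊
  have hCE : 0 ≤ C₂ / E + 1 := by positivity
  rcases le_total (2 * D) (Real.log z) with hzD | hzD
  · have h1 := S.abs_log_inv_le hD1 hD2 hz hzD
    rw [← hE, ← hm] at h1
    set X := 1 / (summatory (sqfreeWeight h) z *
      (∏ p ∈ (Finset.range ⌈z⌉₊).filter Nat.Prime, (1 - g p)) * E)
    have hX : 0 < X := one_div_pos.mpr (mul_pos (mul_pos hGpos hW) hE0)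
    have h2 := abs_exp_sub_one_le_mul_exp (Real.log X)
    rw [Real.exp_log hX] at h2
    have hr1 : D / Real.log z ≤ 1 / 2 := by rw [div_le_iff₀ hlz]; linarith
    have h3 : |Real.log X| ≤ m / 2 :=
      h1.trans (by linarith [mul_le_mul_of_nonneg_left hr1 hm0])
    calc |X - 1| ≤ |Real.log X| * Real.exp |Real.log X| := h2
      _ ≤ m * (D / Real.log z) * Real.exp (m / 2) := by gcongr
      _ = m * Real.exp (m / 2) * (D / Real.log z) := by ring
      _ ≤ _ := by
          refine mul_le_mul_of_nonneg_right ?_ hr0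
          linarith
  · have h1 := S.one_le_const_mul_summatory_mul_prod hz
    rw [← hC₂] at h1
    set Y := summatory (sqfreeWeight h) z *
      (∏ p ∈ (Finset.range ⌈z⌉₊).filter Nat.Prime, (1 - g p))
    have hY : 0 < Y := mul_pos hGpos hW
    have h2 : 1 / (Y * E) ≤ C₂ / E := by
      rw [div_le_div_iff₀ (mul_pos hY hE0) hE0]
      nlinarith
    have h3 : 0 < 1 / (Y * E) := one_div_pos.mpr (mul_pos hY hE0)
    have h4 : |1 / (Y * E) - 1| ≤ C₂ / E + 1 := by
      rw [abs_le]
      constructor <;> linarith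
    have hr1 : 1 ≤ 2 * (D / Real.log z) := by
      rw [← mul_div_assoc, le_div_iff₀ hlz]
      linarith
    have h5 : 0 ≤ m * Real.exp (m / 2) * (D / Real.log z) := by positivity
    nlinarith [mul_le_mul_of_nonneg_left hr1 hCE]

end SieveDensity

end Asymptotics

/-- Lemma 5.4 of Halberstam–Richert: with `g`, `h` multiplicative, `h(p) = g(p)/(1-g(p))`,
under conditions (i) and (ii), `H(z) = ∑_{k ≤ z} μ(k)² h(k)` and
`W(z) = ∏_{p < z} (1 - g(p))` satisfy
`1/H(z) = W(z) e^{γκ} Γ(κ+1) (1 + O(L/ln z))`,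
with the implied constant depending only on `A₁`, `A₂`, `κ`. -/
theorem inv_H_asymptotic (A₁ A₂ κ : ℝ) (hA₁ : 1 ≤ A₁) (hA₂ : 0 < A₂) (hκ : 0 < κ) :
    ∃ C : ℝ, 0 < C ∧ ∀ g h : ℕ → ℝ, g 1 = 1 →
      (∀ m n : ℕ, Nat.Coprime m n → g (m * n) = g m * g n) →
      h 1 = 1 → (∀ m n : ℕ, Nat.Coprime m n → h (m * n) = h m * h n) →
      (∀ p : ℕ, p.Prime → 0 ≤ g p ∧ g p < 1) →
      (∀ p : ℕ, p.Prime → h p = g p / (1 - g p)) →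
      ∀ L : ℝ, 0 < L →
      (∀ p : ℕ, p.Prime → g p ≤ 1 - 1 / A₁) →
      (∀ u v : ℝ, 2 ≤ u → u ≤ v →
        -L ≤ (∑ p ∈ (Finset.Ico ⌈u⌉₊ ⌈v⌉₊).filter Nat.Prime, g p * Real.log p) -
            κ * Real.log (v / u) ∧
          (∑ p ∈ (Finset.Ico ⌈u⌉₊ ⌈v⌉₊).filter Nat.Prime, g p * Real.log p) -
            κ * Real.log (v / u) ≤ A₂) →
      ∀ z : ℝ, 2 ≤ z → ∃ θ : ℝ, |θ| ≤ 1 ∧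
        1 / (∑ k ∈ Finset.Icc 1 ⌊z⌋₊, (ArithmeticFunction.moebius k : ℝ) ^ 2 * h k) =
          (∏ p ∈ (Finset.range ⌈z⌉₊).filter Nat.Prime, (1 - g p)) *
            Real.exp (Real.eulerMascheroniConstant * κ) * Real.Gamma (κ + 1) *
            (1 + θ * C * L / Real.log z) := by
  obtain ⟨Q, hQ⟩ : ∃ Q, Q = A₂ + κ + 2 * A₁ * (A₂ + κ) * (κ + 2 * (A₂ + κ)) := ⟨_, rfl⟩
  obtain ⟨m, hm⟩ : ∃ m, m = 2 * κ + 3 + (2 + 5 * A₁ * (A₂ + κ)) + A₁ := ⟨_, rfl⟩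
  obtain ⟨C₂, hC₂⟩ : ∃ C₂, C₂ = 2 * Real.exp (A₁ * (κ * (4 * (κ + 1)) + A₂)) +
    Real.exp (A₁ * ((κ * (4 * A₂ + 4 * (κ + 1)) + A₂) / Real.log 2)) := ⟨_, rfl⟩
  obtain ⟨E, hE⟩ : ∃ E, E = Real.exp (Real.eulerMascheroniConstant * κ) *
    Real.Gamma (κ + 1) := ⟨_, rfl⟩
  have hQ0 : 0 < Q := by rw [hQ]; positivity
  have hm0 : 0 < m := by rw [hm]; positivity
  have hC0 : 0 < C₂ := by rw [hC₂]; positivity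
  have hE0 : 0 < E := by
    rw [hE]
    exact mul_pos (Real.exp_pos _) (Real.Gamma_pos_of_pos (by linarith))
  obtain ⟨C, hC⟩ : ∃ C, C = (m * Real.exp (m / 2) + 2 * (C₂ / E + 1)) * (6 + 5 * Q / κ) :=
    ⟨_, rfl⟩
  have hCpos : 0 < C := by rw [hC]; positivity
  refine ⟨C, hCpos, ?_⟩
  intro g h _ _ h_one h_mul g_mem h_prime L hL g_le bound z hz
  have S : SieveDensity A₁ A₂ κ L g h :=
    ⟨hA₁, hA₂, hκ, hL, h_one, h_mul, g_mem, h_prime, g_le, bound⟩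
  have hD1 : 6 * L ≤ (6 + 5 * Q / κ) * L := by
    have : 0 < 5 * Q / κ * L := by positivity
    linarith
  have hD2 : Q ≤ (6 + 5 * Q / κ) * L := by
    have h1 : Q = Q / κ * κ := by field_simp
    have h2 := mul_le_mul_of_nonneg_left S.κ_le (by positivity : 0 ≤ Q / κ)
    rw [← h1] at h2
    have h3 : (6 + 5 * Q / κ) * L = 6 * L + Q / κ * (5 * L) := by ring
    linarith
  have key := S.abs_inv_sub_one_le hD1 (hQ ▸ hD2) hz hm hC₂ hE
  have hlz : 0 < Real.log z := Real.log_pos (by linarith)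
  have hG : ∑ k ∈ Finset.Icc 1 ⌊z⌋₊, (ArithmeticFunction.moebius k : ℝ) ^ 2 * h k =
      summatory (sqfreeWeight h) z := by
    refine Finset.sum_subset (Finset.Icc_subset_Icc zero_le_one le_rfl) fun k hk hk' => ?_
    have : k = 0 := by
      rw [Finset.mem_Icc] at hk hk'
      omega
    rw [this]
    exact sqfreeWeight_zero h
  have hGpos : 0 < summatory (sqfreeWeight h) z :=
    zero_lt_one.trans_le (S.one_le_summatory (by linarith))
  have hW := S.prod_pos ⌈z⌉₊
  rw [hG, mul_assoc (∏ p ∈ (Finset.range ⌈z⌉₊).filter Nat.Prime, (1 - g p)), ← hE]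
  set G := summatory (sqfreeWeight h) z
  set W := ∏ p ∈ (Finset.range ⌈z⌉₊).filter Nat.Prime, (1 - g p)
  refine ⟨(1 / (G * W * E) - 1) / (C * L / Real.log z), ?_, ?_⟩
  · have hpos : 0 < C * L / Real.log z := by positivity
    rw [abs_div, abs_of_pos hpos, div_le_one hpos]
    refine key.trans_eq ?_
    rw [hC]
    ring
  · field_simp
    ring
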